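/- Consider the Gaussian sequence model with noise level σₙ and the SNR-aware parameter space Θ(kₙ, τₙ). Suppose εₙ = kₙ/n → 0, μₙ = τₙ/σₙ → ∞ and μₙ = o(√(log εₙ⁻¹)) as n → ∞. Then: (a) the minimax risk satisfies R(Θ(kₙ,τₙ), σₙ) ≥ n σₙ² ( εₙ μₙ² − (1/2) εₙ² μₙ² e^{μₙ²} (1+o(1)) ); (b) the soft–linear estimator η̂_E(y, λₙ, γₙ) with tuning λₙ = 2σₙμₙ and γₙ = (2 εₙ μₙ² e^{(3/2)μₙ²})⁻¹ − 1 satisfies sup over θ ∈ Θ(kₙ,τₙ) of E_θ‖η̂_E(y,λₙ,γₙ) − θ‖₂² = n σₙ² ( εₙ μₙ² − (√(2/π)+o(1)) εₙ² μₙ e^{μₙ²} ); in particular R(Θ(kₙ,τₙ), σₙ) is at most this quantity. -/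

import Mathlib

open MeasureTheory ProbabilityTheory Filter
open scoped ENNReal NNReal Topology

noncomputable section

/-- Gaussian sequence model: the law of `y` under parameter `θ`, the product of
the Gaussians `N(θ i, σ²)`. -/
def gsm (n : ℕ) (θ : Fin n → ℝ) (σ : ℝ) : Measure (Fin n → ℝ) :=
  MeasureTheory.Measure.pi fun i => gaussianReal (θ i) ((σ ^ 2).toNNReal)

/-- Squared-error risk `E_θ ‖est(y) − θ‖₂²` of an estimator at parameter `θ`. -/
def risk (n : ℕ) (σ : ℝ) (est : (Fin n → ℝ) → Fin n → ℝ) (θ : Fin n → ℝ) : ℝ≥0∞ :=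
  ∫⁻ y, ENNReal.ofReal (∑ i, (est y i - θ i) ^ 2) ∂(gsm n θ σ)

/-- The SNR-aware parameter space `Θ(k,τ) = {θ : ‖θ‖₀ ≤ k, ‖θ‖₂² ≤ k τ²}`. -/
def paramSet (n k : ℕ) (τ : ℝ) : Set (Fin n → ℝ) :=
  {θ | {i | θ i ≠ 0}.ncard ≤ k ∧ ∑ i, (θ i) ^ 2 ≤ (k : ℝ) * τ ^ 2}

/-- Minimax risk: infimum over measurable estimators of the supremum risk over `Θ`. -/
def minimaxRisk (n : ℕ) (σ : ℝ) (Θ : Set (Fin n → ℝ)) : ℝ≥0∞ :=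
  ⨅ (est : (Fin n → ℝ) → Fin n → ℝ) (_ : Measurable est), ⨆ θ ∈ Θ, risk n σ est θ

/-- Soft–linear ("elastic") estimator `η̂_E(y,λ,γ) = η̂_S(y,λ)/(1+γ)`. -/
def elasticEst (n : ℕ) (lam gam : ℝ) : (Fin n → ℝ) → Fin n → ℝ :=
  fun y i => (Real.sign (y i) * max (|y i| - lam) 0) / (1 + gam)

abbrev gam0 : Measure ℝ := gaussianReal 0 1

def Hm (j : ℕ) (t : ℝ) : ℝ := ∫ z, (Set.Ici t).indicator (fun z => (z - t) ^ j) z ∂gam0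

def ph (t : ℝ) : ℝ := (Real.sqrt (2 * Real.pi))⁻¹ * Real.exp (-t^2/2)

lemma gamma_int (j : ℕ) {t : ℝ} (ht : 0 < t) :
    IntegrableOn (fun x : ℝ => x ^ j * Real.exp (-(t * x))) (Set.Ioi 0) ∧
    ∫ x in Set.Ioi (0:ℝ), x ^ j * Real.exp (-(t * x)) = j.factorial / t ^ (j+1) := by
  have h1 := Real.integral_rpow_mul_exp_neg_mul_Ioi (a := j + 1) (by positivity) ht
  have e : ∀ x : ℝ, x ^ ((j:ℝ) + 1 - 1) = x ^ j := fun x => by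
    rw [add_sub_cancel_right, Real.rpow_natCast]
  have h2 : ∫ x in Set.Ioi (0:ℝ), x ^ j * Real.exp (-(t * x)) = j.factorial / t ^ (j+1) := by
    simp only [e] at h1
    rw [h1, Real.Gamma_nat_eq_factorial]
    rw [show ((j:ℝ)+1) = ((j+1 : ℕ) : ℝ) by push_cast; ring, Real.rpow_natCast]
    rw [one_div, inv_pow]; field_simp
  refine ⟨?_, h2⟩
  by_contra hc
  rw [integral_undef hc] at h2
  have : (0:ℝ) < j.factorial / t ^ (j+1) := by positivity
  linarith

lemma Hm_eq (j : ℕ) (t : ℝ) :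
    Hm j t = ∫ x in Set.Ioi (0:ℝ), ph t * (x ^ j * Real.exp (-(t * x)) * Real.exp (-x^2/2)) := by
  unfold Hm
  rw [integral_gaussianReal_eq_integral_smul (by norm_num)]
  rw [← integral_add_right_eq_self _ t]
  rw [← integral_Ici_eq_integral_Ioi, ← integral_indicator measurableSet_Ici]
  congr 1
  ext x
  by_cases hx : 0 ≤ x
  · rw [Set.indicator_of_mem (by simpa using hx), Set.indicator_of_mem (by simpa using hx)]
    simp only [gaussianPDFReal, ph, smul_eq_mul]
    have : Real.exp (-(x + t - 0) ^ 2 / (2 * ((1:ℝ≥0):ℝ))) = Real.exp (-t^2/2) * Real.exp (-(t*x)) * Real.exp (-x^2/2) := by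
      rw [← Real.exp_add, ← Real.exp_add]; congr 1; push_cast; ring
    rw [this]
    simp
    ring
  · rw [Set.indicator_of_notMem (by simpa using hx), Set.indicator_of_notMem (by simpa using hx)]
    simp

lemma Hm_bd (j : ℕ) {t : ℝ} (ht : 0 < t) :
    ph t * (j.factorial / t ^ (j+1) - (j+2).factorial / t ^ (j+3) / 2) ≤ Hm j t ∧
    Hm j t ≤ ph t * (j.factorial / t ^ (j+1)) := by
  obtain ⟨i1, e1⟩ := gamma_int j ht
  obtain ⟨i2, e2⟩ := gamma_int (j+2) ht
  have hp : 0 ≤ ph t := by unfold ph; positivity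
  rw [Hm_eq, integral_const_mul]
  have i3 : IntegrableOn (fun x : ℝ => x ^ j * Real.exp (-(t * x)) * Real.exp (-x^2/2)) (Set.Ioi 0) := by
    refine Integrable.mono' i1 (by fun_prop) ?_
    filter_upwards [ae_restrict_mem measurableSet_Ioi] with x hx
    have hx : 0 < x := hx
    rw [Real.norm_of_nonneg (by positivity)]
    apply mul_le_of_le_one_right (by positivity)
    rw [Real.exp_le_one_iff]; nlinarith
  constructor
  · apply mul_le_mul_of_nonneg_left _ hp
    rw [← e1, ← e2, ← integral_div, ← integral_sub i1 (i2.div_const 2)]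
    refine setIntegral_mono_on (i1.sub (i2.div_const 2)) i3 measurableSet_Ioi fun x hx => ?_
    have hx : 0 < x := hx
    have := Real.add_one_le_exp (-x^2/2)
    have h5 : 0 ≤ x ^ j * Real.exp (-(t * x)) := by positivity
    have := mul_le_mul_of_nonneg_left this h5
    calc _ = x ^ j * Real.exp (-(t * x)) * (-x^2/2 + 1) := by ring
      _ ≤ _ := this
  · apply mul_le_mul_of_nonneg_left _ hp
    rw [← e1]
    refine setIntegral_mono_on i3 i1 measurableSet_Ioi fun x hx => ?_
    have hx : 0 < x := hx
    apply mul_le_of_le_one_right (by positivity)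
    rw [Real.exp_le_one_iff]; nlinarith

def sft (l x : ℝ) : ℝ := Real.sign x * max (|x| - l) 0

lemma sft_eq {l : ℝ} (hl : 0 ≤ l) (x : ℝ) : sft l x = max (x - l) 0 - max (-x - l) 0 := by
  unfold sft
  rcases lt_trichotomy x 0 with h | h | h
  · rw [Real.sign_of_neg h, abs_of_neg h, max_eq_right (by linarith : x - l ≤ 0)]; ring
  · subst h; simp
  · rw [Real.sign_of_pos h, abs_of_pos h, max_eq_right (by linarith : -x - l ≤ 0)]; ring

lemma sft_abs {l : ℝ} (hl : 0 ≤ l) (x : ℝ) : |sft l x| ≤ |x| := by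
  rw [sft_eq hl]
  rcases max_cases (x - l) 0 with ⟨h1, h2⟩ | ⟨h1, h2⟩ <;>
  rcases max_cases (-x - l) 0 with ⟨h3, h4⟩ | ⟨h3, h4⟩ <;> rw [h1, h3] <;>
  rw [abs_le] <;> constructor <;> cases abs_cases x <;> linarith

lemma memz : MemLp (fun z : ℝ => z) 2 gam0 := memLp_id_gaussianReal' 2 (by norm_num)

lemma mem_pp (t : ℝ) : MemLp (fun z : ℝ => max (z - t) 0) 2 gam0 :=
  (memz.sub (memLp_const t)).pos_part

lemma mem_pn (t : ℝ) : MemLp (fun z : ℝ => max (-z - t) 0) 2 gam0 :=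
  (memz.neg.sub (memLp_const t)).pos_part

lemma Gp_eq (t : ℝ) : ∫ z, max (z - t) 0 ∂gam0 = Hm 1 t := by
  unfold Hm; congr 1; ext z
  by_cases h : t ≤ z
  · rw [Set.indicator_of_mem (by simpa using h), max_eq_left (by linarith), pow_one]
  · rw [Set.indicator_of_notMem (by simpa using h), max_eq_right (by linarith)]

lemma Qp_eq (t : ℝ) : ∫ z, (max (z - t) 0)^2 ∂gam0 = Hm 2 t := by
  unfold Hm; congr 1; ext z
  by_cases h : t ≤ z
  · rw [Set.indicator_of_mem (by simpa using h), max_eq_left (by linarith)]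
  · rw [Set.indicator_of_notMem (by simpa using h), max_eq_right (by linarith)]; norm_num

lemma neg_int (f : ℝ → ℝ) (hf : Measurable f) : ∫ z, f (-z) ∂gam0 = ∫ z, f z ∂gam0 := by
  have h := gaussianReal_map_neg (μ := 0) (v := 1)
  rw [neg_zero] at h
  conv_rhs => rw [gam0, ← h, integral_map (by fun_prop) hf.aestronglyMeasurable]

lemma Gn_eq (t : ℝ) : ∫ z, max (-z - t) 0 ∂gam0 = Hm 1 t := by
  rw [← Gp_eq]; exact neg_int (fun z => max (z - t) 0) (by fun_prop)

lemma Qn_eq (t : ℝ) : ∫ z, (max (-z - t) 0)^2 ∂gam0 = Hm 2 t := by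
  rw [← Qp_eq]; exact neg_int (fun z => (max (z - t) 0)^2) (by fun_prop)

lemma int_sq : ∫ z, z^2 ∂gam0 = 1 := by
  have := variance_fun_id_gaussianReal (μ := 0) (v := 1)
  rw [variance_of_integral_eq_zero (by fun_prop) (by simp)] at this
  simpa using this

lemma sft_mem {l : ℝ} (hl : 0 ≤ l) (θ : ℝ) : MemLp (fun z => sft l (θ + z)) 2 gam0 := by
  have e : (fun z => sft l (θ + z)) = fun z => max (z - (l - θ)) 0 - max (-z - (l + θ)) 0 := by
    ext z; rw [sft_eq hl]; congr 2 <;> ring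
  rw [e]; exact (mem_pp _).sub (mem_pn _)

lemma sft_mean {l : ℝ} (hl : 0 ≤ l) (θ : ℝ) :
    ∫ z, sft l (θ + z) ∂gam0 = Hm 1 (l - θ) - Hm 1 (l + θ) := by
  have e : (fun z => sft l (θ + z)) = fun z => max (z - (l - θ)) 0 - max (-z - (l + θ)) 0 := by
    ext z; rw [sft_eq hl]; congr 2 <;> ring
  rw [e, integral_sub ((mem_pp _).integrable (by norm_num)) ((mem_pn _).integrable (by norm_num)),
    Gp_eq, Gn_eq]

lemma sft_sq0 {l : ℝ} (hl : 0 ≤ l) : ∫ z, (sft l z)^2 ∂gam0 = 2 * Hm 2 l := by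
  have e : (fun z => (sft l z)^2) = fun z => (max (z - l) 0)^2 + (max (-z - l) 0)^2 := by
    ext z; rw [sft_eq hl]
    rcases max_cases (z - l) 0 with ⟨h1, h2⟩ | ⟨h1, h2⟩ <;>
    rcases max_cases (-z - l) 0 with ⟨h3, h4⟩ | ⟨h3, h4⟩ <;> rw [h1, h3]
    · have : z = l := by linarith
      have : l = 0 := by linarith
      subst this; simp_all
    all_goals ring
  rw [e, integral_add (mem_pp _).integrable_sq (mem_pn _).integrable_sq, Qp_eq, Qn_eq]; ring

def r1 (g l θ : ℝ) : ℝ := ∫ z, (g * sft l (θ + z) - θ)^2 ∂gam0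

lemma r1_int {l : ℝ} (hl : 0 ≤ l) (g θ : ℝ) :
    Integrable (fun z => (g * sft l (θ + z) - θ)^2) gam0 :=
  (((sft_mem hl θ).const_mul g).sub (memLp_const θ)).integrable_sq

lemma r1_eq {l : ℝ} (hl : 0 ≤ l) (g θ : ℝ) :
    r1 g l θ = g^2 * ∫ z, (sft l (θ + z))^2 ∂gam0 - 2 * g * (θ * (Hm 1 (l - θ) - Hm 1 (l + θ))) + θ^2 := by
  have h2 := (sft_mem hl θ).integrable_sq
  have h1 := (sft_mem hl θ).integrable (by norm_num)
  have e : ∀ z, (g * sft l (θ + z) - θ)^2 = (g^2 * (sft l (θ + z))^2 - 2 * g * θ * sft l (θ + z)) + θ^2 := by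
    intro z; ring
  have hs : Integrable (fun z => g^2 * (sft l (θ + z))^2 - 2 * g * θ * sft l (θ + z)) gam0 :=
    (h2.const_mul _).sub (h1.const_mul _)
  unfold r1
  simp_rw [e]
  rw [integral_add hs (integrable_const _),
    integral_sub (h2.const_mul _) (h1.const_mul _), integral_const_mul, integral_const_mul, sft_mean hl]
  simp; ring

lemma r1_zero {l : ℝ} (hl : 0 ≤ l) (g : ℝ) : r1 g l 0 = 2 * g^2 * Hm 2 l := by
  rw [r1_eq hl]; simp [sft_sq0 hl]; ring

lemma sft_sq_le {l : ℝ} (hl : 0 ≤ l) (θ : ℝ) : ∫ z, (sft l (θ + z))^2 ∂gam0 ≤ 2 * θ^2 + 2 := by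
  calc ∫ z, (sft l (θ + z))^2 ∂gam0 ≤ ∫ z, (2 * θ^2 + 2 * z^2) ∂gam0 := by
        refine integral_mono (sft_mem hl θ).integrable_sq
          ((integrable_const _).add (memz.integrable_sq.const_mul 2)) fun z => ?_
        have := sq_le_sq.mpr (sft_abs hl (θ + z))
        simp only
        nlinarith [sq_nonneg (θ - z)]
    _ = _ := by
        rw [integral_add (integrable_const _) (memz.integrable_sq.const_mul 2), integral_const, integral_const_mul, int_sq]
        simp

lemma Hm_nonneg (j : ℕ) (t : ℝ) : 0 ≤ Hm j t := by
  refine integral_nonneg fun z => Set.indicator_nonneg (fun z hz => ?_) z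
  have : t ≤ z := hz
  exact pow_nonneg (by linarith) _

/-- tangent bound -/
lemma tangent {m θ : ℝ} (hm : 0 < m) (hθ : 0 ≤ θ) (hC : Hm 1 m ≤ m * Hm 0 m) :
    m * Hm 1 m + (Hm 0 m / 2 + Hm 1 m / (2 * m)) * (θ^2 - m^2) ≤ θ * Hm 1 (2 * m - θ) := by
  have i0 : Integrable ((Set.Ici m).indicator (fun z => (z - m) ^ 0)) gam0 := by
    simp only [pow_zero]
    exact (integrable_const 1).indicator measurableSet_Ici
  have h1 : Hm 1 m + (θ - m) * Hm 0 m ≤ Hm 1 (2 * m - θ) := by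
    rw [← Gp_eq, ← Gp_eq]
    unfold Hm
    rw [← integral_const_mul, ← integral_add ((mem_pp _).integrable (by norm_num)) (i0.const_mul _)]
    refine integral_mono (((mem_pp _).integrable (by norm_num)).add (i0.const_mul _)) ((mem_pp _).integrable (by norm_num)) fun z => ?_
    simp only
    by_cases h : m ≤ z
    · rw [Set.indicator_of_mem (by simpa using h), max_eq_left (by linarith)]
      refine le_trans (le_of_eq ?_) (le_max_left _ _)
      ring
    · rw [Set.indicator_of_notMem (by simpa using h), max_eq_right (by linarith)]; simp
  have h2 := mul_le_mul_of_nonneg_left h1 hθ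
  refine le_trans ?_ h2
  have h3 : 0 ≤ (m * Hm 0 m - Hm 1 m) * (θ - m)^2 := mul_nonneg (by linarith) (sq_nonneg _)
  have : θ * (Hm 1 m + (θ - m) * Hm 0 m) - (m * Hm 1 m + (Hm 0 m / 2 + Hm 1 m / (2 * m)) * (θ^2 - m^2))
    = (m * Hm 0 m - Hm 1 m) * (θ - m)^2 / (2 * m) := by field_simp; ring
  have : 0 ≤ (m * Hm 0 m - Hm 1 m) * (θ - m)^2 / (2 * m) := by positivity
  linarith

lemma far {m θ : ℝ} (hθ : 0 ≤ θ) : θ * Hm 1 (2 * m + θ) ≤ Hm 2 (2 * m) / 4 := by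
  rw [← Gp_eq, ← Qp_eq, ← integral_const_mul, ← integral_div]
  refine integral_mono (((mem_pp _).integrable (by norm_num)).const_mul _) ((mem_pp _).integrable_sq.div_const _) fun z => ?_
  simp only
  rcases max_cases (z - (2 * m + θ)) 0 with ⟨h1, h2⟩ | ⟨h1, h2⟩
  · rw [h1, max_eq_left (by linarith)]; nlinarith [sq_nonneg (z - 2 * m - 2 * θ)]
  · rw [h1]; simp; positivity

lemma r1_upper {m g : ℝ} (hm : 0 < m) (hg : 0 ≤ g) (hC : Hm 1 m ≤ m * Hm 0 m) (θ : ℝ) :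
    r1 g (2 * m) θ ≤ θ^2 - 2 * g * (m * Hm 1 m + (Hm 0 m / 2 + Hm 1 m / (2 * m)) * (θ^2 - m^2)
      - Hm 2 (2 * m) / 4) + g^2 * (2 * θ^2 + 2) := by
  rw [r1_eq (by linarith)]
  have h1 := mul_le_mul_of_nonneg_left (sft_sq_le (l := 2 * m) (by linarith) θ) (sq_nonneg g)
  have h2 : m * Hm 1 m + (Hm 0 m / 2 + Hm 1 m / (2 * m)) * (θ^2 - m^2)
      - Hm 2 (2 * m) / 4 ≤ θ * (Hm 1 (2 * m - θ) - Hm 1 (2 * m + θ)) := by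
    rcases le_total 0 θ with h | h
    · have a := tangent hm h hC
      have b := far (m := m) h
      linarith
    · have h : 0 ≤ -θ := by linarith
      have a := tangent hm h hC
      have b := far (m := m) h
      rw [sub_neg_eq_add, neg_sq] at a
      rw [← sub_eq_add_neg] at b
      linarith
  have h3 := mul_le_mul_of_nonneg_left h2 (by positivity : 0 ≤ 2 * g)
  linarith

lemma r1_lower {m g : ℝ} (hm : 0 < m) (hg : 0 ≤ g) :
    m^2 - 2 * g * (m * Hm 1 m) ≤ r1 g (2 * m) m := by
  rw [r1_eq (by linarith)]
  have h1 : 0 ≤ g^2 * ∫ z, (sft (2 * m) (m + z))^2 ∂gam0 :=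
    mul_nonneg (sq_nonneg _) (integral_nonneg fun z => sq_nonneg _)
  have h2 : 0 ≤ 2 * g * (m * Hm 1 (2 * m + m)) := by
    have := Hm_nonneg 1 (2 * m + m)
    positivity
  rw [show 2 * m - m = m by ring]
  linarith

lemma sft_scale {s : ℝ} (hs : 0 < s) (l x : ℝ) : sft (s * l) (s * x) = s * sft l x := by
  unfold sft
  have h1 : Real.sign (s * x) = Real.sign x := by
    rcases lt_trichotomy x 0 with h | h | h
    · rw [Real.sign_of_neg h, Real.sign_of_neg (mul_neg_of_pos_of_neg hs h)]
    · subst h; simp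
    · rw [Real.sign_of_pos h, Real.sign_of_pos (mul_pos hs h)]
  rw [h1, abs_mul, abs_of_pos hs, ← mul_sub, ← mul_zero s, ← mul_max_of_nonneg _ _ hs.le]
  simp; ring

lemma meas_sft (l : ℝ) (hl : 0 ≤ l) : Measurable (sft l) := by
  have : sft l = fun x => max (x - l) 0 - max (-x - l) 0 := funext (sft_eq hl)
  rw [this]; fun_prop

lemma gauss_map {s : ℝ} (θ : ℝ) :
    gaussianReal θ ((s ^ 2).toNNReal) = gam0.map (fun z => θ + s * z) := by
  have h1 := gaussianReal_map_const_mul (μ := 0) (v := 1) s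
  have h2 := gaussianReal_map_const_add (μ := s * 0) (v := NNReal.mk (s^2) (sq_nonneg _) * 1) θ
  rw [← h1, Measure.map_map (by fun_prop) (by fun_prop)] at h2
  have e : ((fun x => θ + x) ∘ fun x => s * x) = fun z => θ + s * z := rfl
  rw [e] at h2
  rw [gam0, h2]
  congr 1
  · simp
  · rw [mul_one]; ext; simp [sq_nonneg]

lemma coord_risk {s m : ℝ} (hs : 0 < s) (hm : 0 ≤ m) (γ θ : ℝ) :
    ∫⁻ y, ENNReal.ofReal ((Real.sign y * max (|y| - 2 * s * m) 0 / (1 + γ) - θ)^2)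
      ∂(gaussianReal θ ((s ^ 2).toNNReal)) = ENNReal.ofReal (s^2 * r1 (1 + γ)⁻¹ (2 * m) (θ / s)) := by
  have hl : 0 ≤ 2 * m := by linarith
  have hl' : 0 ≤ 2 * s * m := by positivity
  have e0 : ∀ y, Real.sign y * max (|y| - 2 * s * m) 0 = sft (2 * s * m) y := fun y => rfl
  simp_rw [e0]
  have hM := meas_sft _ hl'
  rw [gauss_map, lintegral_map (by fun_prop) (by fun_prop)]
  have e1 : ∀ z, (sft (2 * s * m) (θ + s * z) / (1 + γ) - θ)^2
      = s^2 * ((1 + γ)⁻¹ * sft (2 * m) (θ / s + z) - θ / s)^2 := by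
    intro z
    have : sft (2 * s * m) (θ + s * z) = s * sft (2 * m) (θ / s + z) := by
      rw [← sft_scale hs]; congr 1
      · ring
      · field_simp
    rw [this]; field_simp
  simp_rw [e1]
  unfold r1
  rw [← integral_const_mul, ofReal_integral_eq_lintegral_ofReal ((r1_int hl _ _).const_mul _)
    (Eventually.of_forall fun z => by simp only [Pi.zero_apply]; positivity)]

lemma meas_elastic (n : ℕ) {l : ℝ} (hl : 0 ≤ l) (γ : ℝ) : Measurable (elasticEst n l γ) := by
  refine measurable_pi_lambda _ fun i => ?_
  have hM := meas_sft _ hl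
  have : (fun y : Fin n → ℝ => elasticEst n l γ y i) = fun y => sft l (y i) / (1 + γ) := rfl
  rw [this]; fun_prop

lemma r1_nonneg (g l θ : ℝ) : 0 ≤ r1 g l θ := integral_nonneg fun z => sq_nonneg _

lemma risk_eq (n : ℕ) {s m : ℝ} (hs : 0 < s) (hm : 0 ≤ m) (γ : ℝ) (θ : Fin n → ℝ) :
    risk n s (elasticEst n (2 * s * m) γ) θ =
      ENNReal.ofReal (s^2 * ∑ i, r1 (1 + γ)⁻¹ (2 * m) (θ i / s)) := by
  unfold risk
  have hM := meas_elastic n (l := 2 * s * m) (by positivity) γ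
  simp_rw [ENNReal.ofReal_sum_of_nonneg (fun i _ => sq_nonneg _)]
  rw [lintegral_finsetSum _ (fun i _ => by fun_prop), Finset.mul_sum,
    ENNReal.ofReal_sum_of_nonneg (fun i _ => mul_nonneg (sq_nonneg _) (r1_nonneg _ _ _))]
  refine Finset.sum_congr rfl fun i _ => ?_
  rw [← coord_risk hs hm]
  unfold gsm elasticEst
  have hM1 := meas_sft (2 * s * m) (by positivity)
  have e0 : ∀ y, Real.sign y * max (|y| - 2 * s * m) 0 = sft (2 * s * m) y := fun y => rfl
  simp_rw [e0]
  exact (measurePreserving_eval (fun i => gaussianReal (θ i) ((s ^ 2).toNNReal)) i).lintegral_comp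
    (f := fun y => ENNReal.ofReal ((sft (2 * s * m) y / (1 + γ) - θ i)^2)) (by fun_prop)

lemma sup_upper (n k : ℕ) (hkn : k ≤ n) {s m g : ℝ} (hs : 0 < s) (hm : 0 < m) (hg : 0 ≤ g)
    (hC : Hm 1 m ≤ m * Hm 0 m) (hb : 2 * g * (Hm 0 m / 2 + Hm 1 m / (2 * m)) ≤ 1)
    (θ : Fin n → ℝ) (hθ : θ ∈ paramSet n k (s * m)) :
    ∑ i, r1 g (2 * m) (θ i / s) ≤ n * (2 * g^2 * Hm 2 (2 * m)) + k * m^2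
      - 2 * g * k * (m * Hm 1 m - Hm 2 (2 * m) / 4) + g^2 * (2 * k * m^2 + 2 * k) := by
  classical
  obtain ⟨h1, h2⟩ := hθ
  have hc : (Finset.univ.filter (fun i => θ i ≠ 0)).card ≤ k := by
    rw [← Set.ncard_coe_finset]; simpa using h1
  obtain ⟨S, hS1, hS2⟩ := Finset.exists_superset_card_eq hc (by simpa using hkn)
  have h0 : ∀ i ∉ S, θ i = 0 := by
    intro i hi
    by_contra h
    exact hi (hS1 (by simpa using h))
  set b := Hm 0 m / 2 + Hm 1 m / (2 * m) with hbdef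
  set U := ∑ i ∈ S, (θ i / s)^2 with hU
  have hUle : U ≤ k * m^2 := by
    have : U = (∑ i ∈ S, (θ i)^2) / s^2 := by
      rw [hU, Finset.sum_div]; exact Finset.sum_congr rfl fun i _ => by rw [div_pow]
    rw [this, div_le_iff₀ (by positivity)]
    calc ∑ i ∈ S, (θ i)^2 ≤ ∑ i, (θ i)^2 :=
          Finset.sum_le_sum_of_subset_of_nonneg (Finset.subset_univ _) fun i _ _ => sq_nonneg _
      _ ≤ _ := h2
      _ = _ := by ring
  rw [← Finset.sum_add_sum_compl S]
  have hA : ∑ i ∈ S, r1 g (2 * m) (θ i / s) ≤ U - 2 * g * (k * (m * Hm 1 m - Hm 2 (2 * m) / 4) + b * (U - k * m^2))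
      + g^2 * (2 * U + 2 * k) := by
    calc _ ≤ ∑ i ∈ S, ((1 - 2 * g * b + 2 * g^2) * (θ i / s)^2 + (- 2 * g * (m * Hm 1 m - b * m^2
      - Hm 2 (2 * m) / 4) + 2 * g^2)) := by
          refine Finset.sum_le_sum fun i _ => ?_
          refine (r1_upper hm hg hC (θ i / s)).trans (le_of_eq ?_)
          rw [← hbdef]; ring
      _ = _ := by
          rw [Finset.sum_add_distrib, ← Finset.mul_sum, ← hU, Finset.sum_const, hS2, nsmul_eq_mul]
          ring
  have hB : ∑ i ∈ Sᶜ, r1 g (2 * m) (θ i / s) ≤ n * (2 * g^2 * Hm 2 (2 * m)) := by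
    have : ∑ i ∈ Sᶜ, r1 g (2 * m) (θ i / s) = ∑ i ∈ Sᶜ, (2 * g^2 * Hm 2 (2 * m)) := by
      refine Finset.sum_congr rfl fun i hi => ?_
      rw [h0 i (by simpa using hi), zero_div, r1_zero (by linarith)]
    rw [this, Finset.sum_const, nsmul_eq_mul]
    have hH := Hm_nonneg 2 (2 * m)
    refine mul_le_mul_of_nonneg_right ?_ (by positivity)
    have := Finset.card_le_univ (Sᶜ)
    simp only [Fintype.card_fin] at this
    exact_mod_cast this
  have h4 : (1 - 2 * g * b) * (k * m^2 - U) ≥ 0 := mul_nonneg (by linarith) (by linarith)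
  have h5 : g^2 * (k * m^2 - U) ≥ 0 := mul_nonneg (by positivity) (by linarith)
  linarith

lemma sup_lower (n k : ℕ) (hkn : k ≤ n) {s m g : ℝ} (hs : 0 < s) (hm : 0 < m) (hg : 0 ≤ g) :
    ∃ θ ∈ paramSet n k (s * m),
    (n - k) * (2 * g^2 * Hm 2 (2 * m)) + k * m^2 - 2 * g * k * (m * Hm 1 m) ≤
      ∑ i, r1 g (2 * m) (θ i / s) := by
  classical
  obtain ⟨S, -, hS2⟩ := Finset.exists_superset_card_eq (s := (∅ : Finset (Fin n))) (n := k)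
    (by simp) (by simpa using hkn)
  refine ⟨fun i => if i ∈ S then s * m else 0, ⟨?_, ?_⟩, ?_⟩
  · have : {i | (if i ∈ S then s * m else 0) ≠ 0} = (S : Set (Fin n)) := by
      ext i; simp [hs.ne', hm.ne']
    rw [this, Set.ncard_coe_finset, hS2]
  · simp [ite_pow, hS2]
  · rw [← Finset.sum_add_sum_compl S]
    have a : ∑ i ∈ S, r1 g (2 * m) ((if i ∈ S then s * m else 0) / s) = k * r1 g (2 * m) m := by
      rw [← hS2, ← nsmul_eq_mul, ← Finset.sum_const]
      refine Finset.sum_congr rfl fun i hi => ?_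
      rw [if_pos hi]; congr 1; field_simp
    have b : ∑ i ∈ Sᶜ, r1 g (2 * m) ((if i ∈ S then s * m else 0) / s) = (n - k) * r1 g (2 * m) 0 := by
      have : ((n:ℝ) - k) = (Sᶜ.card : ℝ) := by
        rw [Finset.card_compl, hS2, Fintype.card_fin, Nat.cast_sub hkn]
      rw [this, ← nsmul_eq_mul, ← Finset.sum_const]
      refine Finset.sum_congr rfl fun i hi => ?_
      rw [if_neg (by simpa using hi), zero_div]
    rw [a, b, r1_zero (by linarith)]
    have := mul_le_mul_of_nonneg_left (r1_lower hm hg) (Nat.cast_nonneg (α := ℝ) k)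
    linarith

lemma eps_exp (ε μ : ℕ → ℝ) (hpos : ∀ᶠ n in atTop, 0 < ε n)
    (hε0 : Tendsto ε atTop (𝓝 0)) (hμtop : Tendsto μ atTop atTop)
    (hμo : Tendsto (fun n => μ n / Real.sqrt (Real.log (ε n)⁻¹)) atTop (𝓝 0)) (C : ℝ) (hC : 0 < C) :
    Tendsto (fun n => ε n * Real.exp (C * μ n ^ 2)) atTop (𝓝 0) := by
  have hs : Tendsto (fun n => Real.exp (Real.log (ε n) / 2)) atTop (𝓝 0) := by
    have h1 : Tendsto (fun n => Real.log (ε n)) atTop atBot := by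
      refine Real.tendsto_log_nhdsGT_zero.comp ?_
      rw [tendsto_nhdsWithin_iff]; exact ⟨hε0, hpos⟩
    exact Real.tendsto_exp_atBot.comp (h1.atBot_div_const (by norm_num))
  have hd : ∀ᶠ n in atTop, μ n / Real.sqrt (Real.log (ε n)⁻¹) < Real.sqrt (1 / (2 * C)) :=
    hμo.eventually (gt_mem_nhds (by positivity))
  have h1 : ∀ᶠ n in atTop, ε n < 1 := hε0.eventually (gt_mem_nhds (by norm_num))
  refine squeeze_zero' (hpos.mono fun n h => by positivity) ?_ hs
  filter_upwards [hpos, hd, h1, hμtop.eventually_gt_atTop 0] with n hp hd h1 hm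
  have hL : 0 < Real.log (ε n)⁻¹ := Real.log_pos ((one_lt_inv₀ hp).mpr h1)
  have h2 : μ n < Real.sqrt (1 / (2 * C)) * Real.sqrt (Real.log (ε n)⁻¹) := by
    rwa [div_lt_iff₀ (by positivity)] at hd
  have h3 : μ n ^ 2 ≤ 1 / (2 * C) * Real.log (ε n)⁻¹ := by
    have := pow_le_pow_left₀ hm.le h2.le 2
    rwa [mul_pow, Real.sq_sqrt (by positivity), Real.sq_sqrt hL.le] at this
  rw [Real.log_inv] at h3
  have h4 : C * μ n ^ 2 ≤ - Real.log (ε n) / 2 := by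
    have := mul_le_mul_of_nonneg_left h3 hC.le
    refine this.trans (le_of_eq ?_); field_simp
  calc ε n * Real.exp (C * μ n ^ 2) = Real.exp (Real.log (ε n) + C * μ n ^ 2) := by
        rw [Real.exp_add, Real.exp_log hp]
    _ ≤ _ := Real.exp_le_exp.mpr (by linarith)

lemma Hm_lim (j : ℕ) : Tendsto (fun x => Real.exp (x^2/2) * x^(j+1) * Hm j x) atTop
    (𝓝 ((Real.sqrt (2 * Real.pi))⁻¹ * j.factorial)) := by
  set s := (Real.sqrt (2 * Real.pi))⁻¹ with hs
  have hlow : Tendsto (fun x : ℝ => s * (j.factorial - (j+2).factorial / 2 * (x^2)⁻¹)) atTop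
      (𝓝 (s * (j.factorial - (j+2).factorial / 2 * 0))) := by
    have : Tendsto (fun x : ℝ => (x^2)⁻¹) atTop (𝓝 0) :=
      (tendsto_pow_atTop (by norm_num)).inv_tendsto_atTop
    exact (tendsto_const_nhds.sub (this.const_mul _)).const_mul _
  rw [mul_zero, sub_zero] at hlow
  refine tendsto_of_tendsto_of_tendsto_of_le_of_le' hlow tendsto_const_nhds ?_ ?_
  all_goals
    filter_upwards [eventually_gt_atTop 0] with x hx
    have hb := Hm_bd j hx
    have e : Real.exp (x^2/2) * ph x = s := by
      unfold ph; rw [← hs, mul_left_comm, ← Real.exp_add]; ring_nf; simp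
  · have := mul_le_mul_of_nonneg_left hb.1 (by positivity : 0 ≤ Real.exp (x^2/2) * x^(j+1))
    refine le_trans (le_of_eq ?_) this
    rw [← e]; field_simp; ring
  · have := mul_le_mul_of_nonneg_left hb.2 (by positivity : 0 ≤ Real.exp (x^2/2) * x^(j+1))
    refine this.trans (le_of_eq ?_)
    rw [← e]; field_simp

lemma hC_ev : ∀ᶠ m : ℝ in atTop, Hm 1 m ≤ m * Hm 0 m ∧ Hm 0 m ≤ 1 ∧ Hm 1 m ≤ 1 := by
  filter_upwards [eventually_ge_atTop 2] with m hm
  have hm0 : 0 < m := by linarith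
  have h0 := Hm_bd 0 hm0
  have h1 := Hm_bd 1 hm0
  norm_num [Nat.factorial] at h0 h1
  have hp : 0 ≤ ph m := by unfold ph; positivity
  have hp1 : ph m ≤ 1 := by
    unfold ph
    have : (1:ℝ) ≤ Real.sqrt (2 * Real.pi) := by
      rw [Real.one_le_sqrt]; linarith [Real.pi_gt_three]
    have a := inv_le_one_of_one_le₀ this
    have b : Real.exp (-m^2/2) ≤ 1 := by rw [Real.exp_le_one_iff]; nlinarith
    have := mul_le_mul a b (by positivity) (by norm_num)
    linarith
  have i1 : m⁻¹ ≤ 1/2 := by rw [inv_le_comm₀ hm0 (by norm_num)]; norm_num; exact hm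
  have i0 : 0 < m⁻¹ := by positivity
  have i2 : (m^2)⁻¹ ≤ 1/4 := by rw [← inv_pow]; nlinarith
  have i3 : 0 < (m^2)⁻¹ := by positivity
  refine ⟨?_, ?_, ?_⟩
  · have := mul_le_mul_of_nonneg_left h0.1 hm0.le
    refine le_trans h1.2 (le_trans ?_ this)
    have e : m * (ph m * (m⁻¹ - 2 / m ^ 3 / 2)) = ph m * (1 - (m^2)⁻¹) := by field_simp
    rw [e]
    exact mul_le_mul_of_nonneg_left (by linarith) hp
  · nlinarith
  · nlinarith

lemma cbounds {n k ε m s g H1 H2 : ℝ} (hn : 0 < n) (hε : 0 < ε) (hk : k = ε * n) (hm : 0 < m) (hs : 0 < s)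
    (hg : g = 2 * ε * m^2 * Real.exp (3/2 * m^2)) :
    (k * (s*m)^2 - s^2 * ((n - k) * (2 * g^2 * H2) + k * m^2 - 2 * g * k * (m * H1))) / (n * s^2 * ε^2 * m * Real.exp (m^2))
      = 4 * (Real.exp (m^2/2) * m^(1+1) * H1) - (1 - ε) * (Real.exp ((2*m)^2/2) * (2*m)^(2+1) * H2) ∧
    (k * (s*m)^2 - s^2 * (n * (2 * g^2 * H2) + k * m^2
      - 2 * g * k * (m * H1 - H2 / 4) + g^2 * (2 * k * m^2 + 2 * k))) / (n * s^2 * ε^2 * m * Real.exp (m^2))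
      = 4 * (Real.exp (m^2/2) * m^(1+1) * H1) - (Real.exp ((2*m)^2/2) * (2*m)^(2+1) * H2)
        - (Real.exp ((2*m)^2/2) * (2*m)^(2+1) * H2) * (8 * m^2 * Real.exp (3/2 * m^2))⁻¹
        - 8 * (ε * Real.exp (2 * m^2) * m^3 * (m^2+1)) := by
  set E := Real.exp (m^2/2) with hE
  have hEp : 0 < E := Real.exp_pos _
  have e1 : Real.exp (m^2) = E^2 := by rw [hE, ← Real.exp_nat_mul]; congr 1; push_cast; ring
  have e2 : Real.exp (3/2 * m^2) = E^3 := by rw [hE, ← Real.exp_nat_mul]; congr 1; push_cast; ring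
  have e3 : Real.exp ((2*m)^2/2) = E^4 := by rw [hE, ← Real.exp_nat_mul]; congr 1; push_cast; ring
  have e4 : Real.exp (2*m^2) = E^4 := by rw [hE, ← Real.exp_nat_mul]; congr 1; push_cast; ring
  rw [e2] at hg
  rw [e1, e2, e3, e4, hg, hk]
  constructor <;> field_simp <;> ring

theorem partB
    (k : ℕ → ℕ) (τ σ ε μ : ℕ → ℝ)
    (hk : ∀ n, 1 ≤ n → 1 ≤ k n ∧ k n ≤ n)
    (hσ : ∀ n, 0 < σ n)
    (hε : ∀ n, ε n = (k n : ℝ) / n) (hμ : ∀ n, μ n = τ n / σ n)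
    (hε0 : Tendsto ε atTop (𝓝 0)) (hμtop : Tendsto μ atTop atTop)
    (hμo : Tendsto (fun n => μ n / Real.sqrt (Real.log (ε n)⁻¹)) atTop (𝓝 0)) :
    (∃ c : ℕ → ℝ, Tendsto c atTop (𝓝 (Real.sqrt (2 / Real.pi))) ∧
      ∀ᶠ n : ℕ in atTop,
        (⨆ θ ∈ paramSet n (k n) (τ n),
            risk n (σ n)
              (elasticEst n (2 * σ n * μ n)
                ((2 * ε n * μ n ^ 2 * Real.exp (3 / 2 * μ n ^ 2))⁻¹ - 1)) θ) =
          ENNReal.ofReal ((n : ℝ) * σ n ^ 2 *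
            (ε n * μ n ^ 2 - c n * ε n ^ 2 * μ n * Real.exp (μ n ^ 2))) ∧
        minimaxRisk n (σ n) (paramSet n (k n) (τ n)) ≤
          ENNReal.ofReal ((n : ℝ) * σ n ^ 2 *
            (ε n * μ n ^ 2 - c n * ε n ^ 2 * μ n * Real.exp (μ n ^ 2)))) := by
  have hpos : ∀ᶠ n in atTop, 0 < ε n := by
    filter_upwards [eventually_ge_atTop 1] with n hn
    have := (hk n hn).1
    rw [hε]
    have : (0:ℝ) < k n := by exact_mod_cast this
    have : (0:ℝ) < n := by exact_mod_cast hn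
    positivity
  have hEE := eps_exp ε μ hpos hε0 hμtop hμo
  set V : ℕ → ℝ≥0∞ := fun n => (⨆ θ ∈ paramSet n (k n) (τ n),
            risk n (σ n)
              (elasticEst n (2 * σ n * μ n)
                ((2 * ε n * μ n ^ 2 * Real.exp (3 / 2 * μ n ^ 2))⁻¹ - 1)) θ) with hV
  set g : ℕ → ℝ := fun n => 2 * ε n * μ n ^ 2 * Real.exp (3 / 2 * μ n ^ 2) with hg
  have poly : ∀ x : ℝ, x^2 ≤ Real.exp (x^2) := fun x => by
    have := Real.add_one_le_exp (x^2); linarith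
  have hg0 : Tendsto g atTop (𝓝 0) := by
    have h1 := (hEE (5/2) (by norm_num)).const_mul 2
    rw [mul_zero] at h1
    refine squeeze_zero' (hpos.mono fun n h => by simp only [hg]; positivity) ?_ h1
    filter_upwards [hpos] with n h
    simp only [hg]
    rw [show (5/2 : ℝ) * μ n ^ 2 = μ n ^ 2 + 3 / 2 * μ n ^ 2 by ring, Real.exp_add]
    have := mul_le_mul_of_nonneg_left (poly (μ n)) (by positivity : 0 ≤ 2 * ε n * Real.exp (3/2 * μ n^2))
    linarith
  have hg1 : ∀ᶠ n in atTop, g n < 1/2 := hg0.eventually (gt_mem_nhds (by norm_num))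
  have key : ∀ᶠ n : ℕ in atTop, 0 < (n:ℝ) ∧ 0 < ε n ∧ 0 < μ n ∧ V n ≠ ⊤ ∧
      (σ n)^2 * ((n - k n) * (2 * g n^2 * Hm 2 (2 * μ n)) + k n * μ n^2 - 2 * g n * k n * (μ n * Hm 1 (μ n))) ≤ (V n).toReal ∧
      (V n).toReal ≤ (σ n)^2 * (n * (2 * g n^2 * Hm 2 (2 * μ n)) + k n * μ n^2
      - 2 * g n * k n * (μ n * Hm 1 (μ n) - Hm 2 (2 * μ n) / 4) + g n^2 * (2 * k n * μ n^2 + 2 * k n)) := by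
    filter_upwards [eventually_ge_atTop 1, hpos, hμtop.eventually_gt_atTop 1, hg1, hμtop.eventually hC_ev]
      with n hn hp hm hg1 hC
    have hnp : (0:ℝ) < n := by exact_mod_cast hn
    have hm0 : 0 < μ n := by linarith
    have hgp : 0 < g n := by simp only [hg]; positivity
    have hτ : τ n = σ n * μ n := by rw [hμ]; field_simp [(hσ n).ne']
    have hgi : (1 + ((2 * ε n * μ n ^ 2 * Real.exp (3 / 2 * μ n ^ 2))⁻¹ - 1))⁻¹ = g n := by
      simp only [hg]; rw [add_sub_cancel, inv_inv]
    have hkn := (hk n hn).2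
    have hb : 2 * g n * (Hm 0 (μ n) / 2 + Hm 1 (μ n) / (2 * μ n)) ≤ 1 := by
      have h1 : Hm 1 (μ n) / (2 * μ n) ≤ 1 / 2 := by
        rw [div_le_iff₀ (by positivity)]; nlinarith
      have h2 : Hm 0 (μ n) / 2 + Hm 1 (μ n) / (2 * μ n) ≤ 1 := by linarith
      have := mul_le_mul_of_nonneg_left h2 (by positivity : 0 ≤ 2 * g n)
      linarith
    have hup : V n ≤ ENNReal.ofReal ((σ n)^2 * (n * (2 * g n^2 * Hm 2 (2 * μ n)) + k n * μ n^2
      - 2 * g n * k n * (μ n * Hm 1 (μ n) - Hm 2 (2 * μ n) / 4) + g n^2 * (2 * k n * μ n^2 + 2 * k n))) := by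
      refine iSup₂_le fun θ hθ => ?_
      rw [risk_eq n (hσ n) hm0.le, hgi]
      rw [hτ] at hθ
      exact ENNReal.ofReal_le_ofReal (mul_le_mul_of_nonneg_left
        (sup_upper n (k n) hkn (hσ n) hm0 hgp.le hC.1 hb θ hθ) (sq_nonneg _))
    have hVt : V n ≠ ⊤ := ne_top_of_le_ne_top ENNReal.ofReal_ne_top hup
    obtain ⟨θ, hθ, hle⟩ := sup_lower n (k n) hkn (hσ n) hm0 hgp.le
    have hlow : ENNReal.ofReal ((σ n)^2 * ∑ i, r1 (g n) (2 * μ n) (θ i / σ n)) ≤ V n := by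
      rw [← hτ] at hθ
      rw [← hgi, ← risk_eq n (hσ n) hm0.le]
      exact le_iSup₂ (f := fun θ (_ : θ ∈ paramSet n (k n) (τ n)) => risk n (σ n)
              (elasticEst n (2 * σ n * μ n)
                ((2 * ε n * μ n ^ 2 * Real.exp (3 / 2 * μ n ^ 2))⁻¹ - 1)) θ) θ hθ
    have hsum : (σ n)^2 * ∑ i, r1 (g n) (2 * μ n) (θ i / σ n) ≤ (V n).toReal :=
      (ENNReal.ofReal_le_iff_le_toReal hVt).mp hlow
    refine ⟨hnp, hp, hm0, hVt, (mul_le_mul_of_nonneg_left hle (sq_nonneg _)).trans hsum, ?_⟩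
    have h0 : 0 ≤ (σ n)^2 * (n * (2 * g n^2 * Hm 2 (2 * μ n)) + k n * μ n^2
      - 2 * g n * k n * (μ n * Hm 1 (μ n) - Hm 2 (2 * μ n) / 4) + g n^2 * (2 * k n * μ n^2 + 2 * k n)) :=
      mul_nonneg (sq_nonneg _) ((Finset.sum_nonneg fun i _ => r1_nonneg _ _ _).trans
        (sup_upper n (k n) hkn (hσ n) hm0 hgp.le hC.1 hb θ hθ))
    exact ENNReal.toReal_le_of_le_ofReal h0 hup
  have hkε : ∀ n : ℕ, 0 < (n:ℝ) → (k n : ℝ) = ε n * n := fun n h => by rw [hε]; field_simp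
  have hττ : ∀ n : ℕ, τ n = σ n * μ n := fun n => by rw [hμ]; field_simp [(hσ n).ne']
  refine ⟨fun n => (k n * (σ n * μ n)^2 - (V n).toReal) / (n * σ n^2 * ε n^2 * μ n * Real.exp (μ n^2)), ?_, ?_⟩
  · have hY := ((Hm_lim 1).comp hμtop).const_mul 4
    have h2μ : Tendsto (fun n => 2 * μ n) atTop atTop := hμtop.const_mul_atTop (by norm_num)
    have hX := (Hm_lim 2).comp h2μ
    simp only [Function.comp_def] at hX hY
    have hval : Real.sqrt (2 / Real.pi) = 4 * ((Real.sqrt (2 * Real.pi))⁻¹ * (Nat.factorial 1 : ℝ)) - (Real.sqrt (2 * Real.pi))⁻¹ * (Nat.factorial 2 : ℝ) := by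
      have : Real.sqrt (2 / Real.pi) = 2 * (Real.sqrt (2 * Real.pi))⁻¹ := by
        rw [show 2 / Real.pi = (2:ℝ)^2 / (2 * Real.pi) by field_simp, Real.sqrt_div (by norm_num),
          Real.sqrt_sq (by norm_num)]; rfl
      rw [this]; norm_num [Nat.factorial]; ring
    have hup : Tendsto (fun n => 4 * (Real.exp (μ n^2/2) * μ n^(1+1) * Hm 1 (μ n)) - (1 - ε n) * (Real.exp ((2*μ n)^2/2) * (2*μ n)^(2+1) * Hm 2 (2 * μ n))) atTop (𝓝 (Real.sqrt (2 / Real.pi))) := by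
      have := hY.sub (((tendsto_const_nhds (x := (1:ℝ))).sub hε0).mul hX)
      rw [sub_zero, one_mul, ← hval] at this
      exact this
    have hlo : Tendsto (fun n => 4 * (Real.exp (μ n^2/2) * μ n^(1+1) * Hm 1 (μ n)) - (Real.exp ((2*μ n)^2/2) * (2*μ n)^(2+1) * Hm 2 (2 * μ n))
        - (Real.exp ((2*μ n)^2/2) * (2*μ n)^(2+1) * Hm 2 (2 * μ n)) * (8 * μ n^2 * Real.exp (3/2 * μ n^2))⁻¹
        - 8 * (ε n * Real.exp (2 * μ n^2) * μ n^3 * (μ n^2+1))) atTop (𝓝 (Real.sqrt (2 / Real.pi))) := by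
      have z1 : Tendsto (fun n => (8 * μ n^2 * Real.exp (3/2 * μ n^2))⁻¹) atTop (𝓝 0) := by
        have i1 := hμtop.inv_tendsto_atTop
        refine squeeze_zero' (Eventually.of_forall fun n => by positivity) ?_ i1
        filter_upwards [hμtop.eventually_gt_atTop 1] with n hn
        simp only [Pi.inv_apply]
        refine inv_anti₀ (by linarith) ?_
        have : 1 ≤ Real.exp (3/2 * μ n^2) := Real.one_le_exp (by positivity)
        have h2 : μ n ≤ 8 * μ n^2 := by nlinarith
        have h3 : 0 ≤ 8 * μ n^2 := by positivity
        nlinarith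
      have z2 : Tendsto (fun n => ε n * Real.exp (2 * μ n^2) * μ n^3 * (μ n^2+1)) atTop (𝓝 0) := by
        have h5 := (hEE 5 (by norm_num)).const_mul 2
        rw [mul_zero] at h5
        refine squeeze_zero' ?_ ?_ h5
        · filter_upwards [hpos, hμtop.eventually_gt_atTop 1] with n hp hn
          have : 0 < μ n := by linarith
          positivity
        · filter_upwards [hpos, hμtop.eventually_gt_atTop 1] with n hp hn
          have hm : 0 < μ n := by linarith
          have a : μ n^3 * (μ n^2+1) ≤ 2 * (μ n^2)^3 := by
            have h1 : μ n^2 + 1 ≤ 2 * μ n ^2 := by nlinarith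
            have h2 : μ n^5 ≤ μ n^6 := pow_le_pow_right₀ hn.le (by norm_num)
            calc μ n^3 * (μ n^2+1) ≤ μ n^3 * (2 * μ n ^2) := by gcongr
              _ = 2 * μ n^5 := by ring
              _ ≤ 2 * μ n^6 := by linarith
              _ = _ := by ring
          have b : (μ n^2)^3 ≤ Real.exp (μ n^2)^3 := pow_le_pow_left₀ (by positivity) (poly _) 3
          have e5 : Real.exp (5 * μ n^2) = Real.exp (2 * μ n^2) * Real.exp (μ n^2)^3 := by
            rw [← Real.exp_nat_mul, ← Real.exp_add]; congr 1; push_cast; ring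
          rw [e5]
          calc _ = (ε n * Real.exp (2 * μ n^2)) * (μ n^3 * (μ n^2+1)) := by ring
            _ ≤ (ε n * Real.exp (2 * μ n^2)) * (2 * Real.exp (μ n^2)^3) := by
                refine mul_le_mul_of_nonneg_left (by linarith) (by positivity)
            _ = _ := by ring
      have := ((hY.sub hX).sub (hX.mul z1)).sub (z2.const_mul 8)
      rw [mul_zero, mul_zero, sub_zero, sub_zero, ← hval] at this
      exact this
    refine tendsto_of_tendsto_of_tendsto_of_le_of_le' hlo hup ?_ ?_
    · filter_upwards [key] with n ⟨h1, h2, h3, h4, h5, h6⟩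
      rw [← (cbounds h1 h2 (hkε n h1) h3 (hσ n) rfl).2]
      have := hσ n
      refine div_le_div_of_nonneg_right ?_ (by positivity)
      simp only [hg] at h6
      linarith
    · filter_upwards [key] with n ⟨h1, h2, h3, h4, h5, h6⟩
      rw [← (cbounds h1 h2 (hkε n h1) h3 (hσ n) rfl).1]
      have := hσ n
      refine div_le_div_of_nonneg_right ?_ (by positivity)
      simp only [hg] at h5
      linarith
  · filter_upwards [key] with n ⟨h1, h2, h3, h4, h5, h6⟩
    have hs := hσ n
    have e : (n : ℝ) * σ n ^ 2 * (ε n * μ n ^ 2 - (k n * (σ n * μ n)^2 - (V n).toReal) / (n * σ n^2 * ε n^2 * μ n * Real.exp (μ n^2)) * ε n ^ 2 * μ n * Real.exp (μ n ^ 2))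
      = (V n).toReal := by
      rw [hkε n h1]; field_simp; ring
    rw [e, ENNReal.ofReal_toReal h4]
    refine ⟨rfl, ?_⟩
    exact iInf₂_le (f := fun est (_ : Measurable est) => ⨆ θ ∈ paramSet n (k n) (τ n), risk n (σ n) est θ) _ (meas_elastic n (by positivity) _)

lemma gauss_tilt {s : ℝ} (hs : 0 < s) (a : ℝ) :
    gaussianReal a ((s^2).toNNReal) = (gaussianReal 0 ((s^2).toNNReal)).withDensity
      (fun x => ENNReal.ofReal (Real.exp ((a * x - a^2/2) / s^2))) := by
  have hv : (s^2).toNNReal ≠ 0 := by simp [hs.ne']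
  rw [gaussianReal_of_var_ne_zero _ hv, gaussianReal_of_var_ne_zero _ hv,
    ← withDensity_mul _ (measurable_gaussianPDF _ _) (by fun_prop)]
  congr 1
  ext x
  simp only [Pi.mul_apply, gaussianPDF]
  rw [← ENNReal.ofReal_mul (gaussianPDFReal_nonneg _ _ _)]
  congr 1
  simp only [gaussianPDFReal]
  conv_rhs => rw [mul_assoc, ← Real.exp_add]
  congr 2
  rw [Real.coe_toNNReal _ (sq_nonneg s)]
  field_simp; ring

lemma gsm_tilt (n : ℕ) (θ : Fin n → ℝ) {s : ℝ} (hs : 0 < s) (i : Fin n) (hi : θ i = 0) (a : ℝ) :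
    gsm n (Function.update θ i a) s = (gsm n θ s).withDensity
      (fun y => ENNReal.ofReal (Real.exp ((a * y i - a^2/2) / s^2))) := by
  classical
  unfold gsm
  refine Measure.pi_eq fun S hS => ?_
  set f : ℝ → ℝ≥0∞ := fun x => ENNReal.ofReal (Real.exp ((a * x - a^2/2) / s^2)) with hf
  have hfm : Measurable f := by fun_prop
  set ν := fun j => gaussianReal (θ j) ((s^2).toNNReal) with hν
  set h : (j : Fin n) → ℝ → ℝ≥0∞ := fun j => (S j).indicator (if j = i then f else fun _ => 1) with hh
  have hhm : ∀ j, Measurable (h j) := by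
    intro j
    refine Measurable.indicator ?_ (hS j)
    split_ifs
    · exact hfm
    · exact measurable_const
  rw [withDensity_apply _ (MeasurableSet.univ_pi hS), ← lintegral_indicator (MeasurableSet.univ_pi hS)]
  have e1 : ∀ y : Fin n → ℝ, (Set.univ.pi S).indicator (fun y => f (y i)) y = ∏ j, h j (y j) := by
    intro y
    by_cases hy : y ∈ Set.univ.pi S
    · rw [Set.indicator_of_mem hy]
      have : ∀ j, h j (y j) = if j = i then f (y j) else 1 := by
        intro j
        simp only [hh]
        rw [Set.indicator_of_mem (hy j (Set.mem_univ j))]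
        split_ifs <;> rfl
      simp_rw [this]
      simp
    · rw [Set.indicator_of_notMem hy]
      simp only [Set.mem_pi, Set.mem_univ, true_implies, not_forall] at hy
      obtain ⟨j, hj⟩ := hy
      symm
      refine Finset.prod_eq_zero (Finset.mem_univ j) ?_
      simp only [hh]; rw [Set.indicator_of_notMem hj]
  refine Eq.trans (lintegral_congr e1) ?_
  have hI : iIndepFun (fun j (y : Fin n → ℝ) => h j (y j)) (Measure.pi ν) :=
    iIndepFun_pi (fun j => (hhm j).aemeasurable)
  rw [lintegral_prod_eq_prod_lintegral_of_indepFun _ _ hI (fun j => (hhm j).comp (measurable_pi_apply j))]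
  refine Finset.prod_congr rfl fun j _ => ?_
  rw [(measurePreserving_eval ν j).lintegral_comp (hhm j)]
  simp only [hh]
  rw [lintegral_indicator (hS j)]
  by_cases hj : j = i
  · subst hj
    simp only [if_true, Function.update_self, hν, hi]
    rw [gauss_tilt hs a, withDensity_apply _ (hS j)]
  · simp [hj, hν]

lemma exp_int (s c : ℝ) : Integrable (fun x => Real.exp (c * x)) (gaussianReal 0 ((s^2).toNNReal)) ∧
    ∫ x, Real.exp (c * x) ∂(gaussianReal 0 ((s^2).toNNReal)) = Real.exp (s^2 * c^2 / 2) := by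
  refine ⟨integrable_exp_mul_gaussianReal c, ?_⟩
  have := congrFun (mgf_id_gaussianReal (μ := 0) (v := (s^2).toNNReal)) c
  simp only [mgf, id] at this
  rw [this, Real.coe_toNNReal _ (sq_nonneg s)]; simp

def psi (m s x : ℝ) : ℝ := (Real.exp (m / s * x - m^2/2) + Real.exp (-(m / s) * x - m^2/2)) / 2

lemma psi_eq (m s x : ℝ) : psi m s x = Real.exp (-m^2/2) / 2 * (Real.exp (m / s * x) + Real.exp (-(m / s) * x)) := by
  unfold psi
  rw [show m / s * x - m^2/2 = -m^2/2 + m / s * x by ring, show -(m / s) * x - m^2/2 = -m^2/2 + -(m / s) * x by ring,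
    Real.exp_add, Real.exp_add]; ring

lemma psi_sq (m s x : ℝ) : (psi m s x)^2 = Real.exp (-m^2) / 4 * (Real.exp (2 * m / s * x) + Real.exp (-(2 * m / s) * x)) + Real.exp (-m^2) / 2 := by
  rw [psi_eq, mul_pow, div_pow, add_sq, ← Real.exp_nat_mul, ← Real.exp_nat_mul, ← Real.exp_nat_mul, mul_assoc, ← Real.exp_add]
  rw [show m / s * x + -(m / s) * x = 0 by ring, Real.exp_zero]
  rw [show ((2:ℕ):ℝ) * (-m^2/2) = -m^2 by push_cast; ring, show ((2:ℕ):ℝ) * (m / s * x) = 2 * m / s * x by push_cast; ring,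
    show ((2:ℕ):ℝ) * (-(m / s) * x) = -(2 * m / s) * x by push_cast; ring]
  ring

lemma psi_int {s : ℝ} (hs : 0 < s) (m : ℝ) :
    Integrable (psi m s) (gaussianReal 0 ((s^2).toNNReal)) ∧ ∫ x, psi m s x ∂(gaussianReal 0 ((s^2).toNNReal)) = 1 := by
  have h1 := exp_int s (m / s)
  have h2 := exp_int s (-(m / s))
  have e : psi m s = fun x => Real.exp (-m^2/2) / 2 * (Real.exp (m / s * x) + Real.exp (-(m / s) * x)) := funext (psi_eq m s)
  rw [e]
  refine ⟨(h1.1.add h2.1).const_mul _, ?_⟩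
  rw [integral_const_mul, integral_add h1.1 h2.1, h1.2, h2.2]
  rw [show s^2 * (m / s)^2 / 2 = m^2/2 by field_simp, show s^2 * (-(m / s))^2 / 2 = m^2/2 by field_simp,
    show -m^2/2 = -(m^2/2) by ring, Real.exp_neg]
  field_simp; norm_num

lemma psi_sq_int {s : ℝ} (hs : 0 < s) (m : ℝ) :
    Integrable (fun x => (psi m s x)^2) (gaussianReal 0 ((s^2).toNNReal)) ∧
    ∫ x, (psi m s x)^2 ∂(gaussianReal 0 ((s^2).toNNReal)) = (Real.exp (m^2) + Real.exp (-m^2)) / 2 := by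
  have h1 := exp_int s (2 * m / s)
  have h2 := exp_int s (-(2 * m / s))
  simp_rw [psi_sq]
  have i1 : Integrable (fun x => Real.exp (-m^2) / 4 * (Real.exp (2 * m / s * x) + Real.exp (-(2 * m / s) * x))) (gaussianReal 0 ((s^2).toNNReal)) :=
    (h1.1.add h2.1).const_mul _
  refine ⟨i1.add (integrable_const _), ?_⟩
  rw [integral_add i1 (integrable_const _), integral_const_mul, integral_add h1.1 h2.1, h1.2, h2.2]
  rw [show s^2 * (2 * m / s)^2 / 2 = m^2 + m^2 by field_simp; ring, show s^2 * (-(2 * m / s))^2 / 2 = m^2 + m^2 by field_simp; ring,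
    Real.exp_add, Real.exp_neg]
  simp
  field_simp; ring

lemma psi_ge (m s x : ℝ) : Real.exp (-m^2/2) ≤ psi m s x := by
  rw [psi_eq]
  have : Real.exp (m / s * x) * Real.exp (-(m / s) * x) = 1 := by
    rw [← Real.exp_add]; simp
  have h2 : 2 ≤ Real.exp (m / s * x) + Real.exp (-(m / s) * x) := by
    have a := Real.exp_pos (m / s * x)
    have b := Real.exp_pos (-(m / s) * x)
    nlinarith [sq_nonneg (Real.exp (m / s * x) - Real.exp (-(m / s) * x))]
  have := Real.exp_pos (-m^2/2)
  nlinarith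

/-- Reciprocal moment bound. -/
lemma recip {Ω : Type*} [MeasurableSpace Ω] (P : Measure Ω) [IsProbabilityMeasure P] (M : ℕ) (hM : 2 ≤ M)
    (X : Fin M → Ω → ℝ) (hX : ∀ i, Measurable (X i)) (hI : iIndepFun X P) (q w : ℝ) (hq : 0 < q)
    (hge : ∀ i ω, q ≤ X i ω) (hmean : ∀ i, ∫ ω, X i ω ∂P = 1) (hL : ∀ i, MemLp (X i) 2 P)
    (hw : ∀ i, ∫ ω, (X i ω)^2 ∂P ≤ w) (hw2 : ∀ i, ∫ ω, ((X i ω)^2 - q^2) ∂P ≤ w / 2) (j : Fin M) :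
    Integrable (fun ω => ((X j ω)^2 - q^2) / ∑ i, X i ω) P ∧
    ∫ ω, ((X j ω)^2 - q^2) / ∑ i, X i ω ∂P ≤ w / 2 / ((M:ℝ) - 1) * (1 + w / q / ((M:ℝ) - 1)) := by
  classical
  set N : ℝ := (M:ℝ) - 1 with hN
  have hNp : 0 < N := by
    have : (2:ℝ) ≤ M := by exact_mod_cast hM
    rw [hN]; linarith
  set E := Finset.univ.erase j with hE
  have hcard : (E.card : ℝ) = N := by
    rw [hE, Finset.card_erase_of_mem (Finset.mem_univ _), Finset.card_univ, Fintype.card_fin, hN,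
      Nat.cast_sub (by omega)]; simp
  set T : Ω → ℝ := ∑ i ∈ E, X i with hT
  have hTm : Measurable T := by 
    have : T = fun ω => ∑ i ∈ E, X i ω := by ext ω; simp [hT]
    rw [this]; exact Finset.measurable_sum _ fun i _ => hX i
  have hTL : MemLp T 2 P := by rw [hT]; exact memLp_finsetSum' _ fun i _ => hL i
  have hTge : ∀ ω, N * q ≤ T ω := by
    intro ω
    rw [hT, Finset.sum_apply, ← hcard, ← nsmul_eq_mul, ← Finset.sum_const]
    exact Finset.sum_le_sum fun i _ => hge i ω
  have hTp : ∀ ω, 0 < T ω := fun ω => lt_of_lt_of_le (by positivity) (hTge ω)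
  have hsum : ∀ ω, ∑ i, X i ω = X j ω + T ω := by
    intro ω
    rw [hT, Finset.sum_apply, hE, Finset.add_sum_erase _ (fun i => X i ω) (Finset.mem_univ j)]
  have hind : IndepFun T (X j) P := hI.indepFun_finsetSum_of_notMem (fun i => hX i) (by simp [hE])
  have hTmean : ∫ ω, T ω ∂P = N := by
    rw [hT]; simp_rw [Finset.sum_apply]
    rw [integral_finsetSum _ fun i _ => (hL i).integrable (by norm_num)]
    simp_rw [hmean]; simp [hcard]
  have hvar : ∫ ω, (T ω - N)^2 ∂P ≤ N * w := by
    have h1 : variance T P = ∫ ω, (T ω - N)^2 ∂P := by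
      rw [variance_eq_integral hTm.aemeasurable, hTmean]
    rw [← h1, hT, IndepFun.variance_sum (fun i _ => hL i) (fun a _ b _ hab => hI.indepFun hab)]
    rw [← hcard, ← nsmul_eq_mul, ← Finset.sum_const]
    refine Finset.sum_le_sum fun i _ => ?_
    exact (variance_le_expectation_sq (hL i).1).trans (hw i)
  have iinv : Integrable (fun ω => (T ω)⁻¹) P := by
    refine Integrable.of_bound (hTm.inv.aestronglyMeasurable) (N * q)⁻¹ (Eventually.of_forall fun ω => ?_)
    rw [Real.norm_of_nonneg (inv_nonneg.mpr (hTp ω).le)]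
    exact inv_anti₀ (by positivity) (hTge ω)
  have isq : Integrable (fun ω => (T ω - N)^2) P := (hTL.sub (memLp_const N)).integrable_sq
  have iT : Integrable T P := hTL.integrable (by norm_num)
  have hinv : ∫ ω, (T ω)⁻¹ ∂P ≤ 1 / N * (1 + w / q / N) := by
    have hpt : ∀ ω, (T ω)⁻¹ ≤ (2 / N - 1 / N^2 * T ω) + 1 / (N^3 * q) * (T ω - N)^2 := by
      intro ω
      have hp := hTp ω
      have a : (T ω)⁻¹ = (2 / N - 1 / N^2 * T ω) + 1 / (N^2 * T ω) * (T ω - N)^2 := by field_simp; ring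
      rw [a]
      have b : 1 / (N^2 * T ω) ≤ 1 / (N^3 * q) := by
        refine one_div_le_one_div_of_le (by positivity) ?_
        have := mul_le_mul_of_nonneg_left (hTge ω) (by positivity : 0 ≤ N^2)
        calc N^3 * q = N^2 * (N * q) := by ring
          _ ≤ _ := this
      have := mul_le_mul_of_nonneg_right b (sq_nonneg (T ω - N))
      linarith
    have i1 : Integrable (fun ω => 2 / N - 1 / N^2 * T ω) P := (integrable_const _).sub (iT.const_mul _)
    calc _ ≤ ∫ ω, ((2 / N - 1 / N^2 * T ω) + 1 / (N^3 * q) * (T ω - N)^2) ∂P :=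
          integral_mono iinv (i1.add (isq.const_mul _)) hpt
      _ = 2 / N - 1 / N^2 * N + 1 / (N^3 * q) * ∫ ω, (T ω - N)^2 ∂P := by
          rw [integral_add i1 (isq.const_mul _), integral_sub (integrable_const _) (iT.const_mul _),
            integral_const_mul, integral_const_mul, hTmean]; simp
      _ ≤ 2 / N - 1 / N^2 * N + 1 / (N^3 * q) * (N * w) := by gcongr
      _ = _ := by field_simp; ring
  have hjnn : ∀ ω, 0 ≤ (X j ω)^2 - q^2 := fun ω => by nlinarith [hge j ω]
  have ij : Integrable (fun ω => (X j ω)^2 - q^2) P := (hL j).integrable_sq.sub (integrable_const _)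
  have hind2 : IndepFun (fun ω => (T ω)⁻¹) (fun ω => (X j ω)^2 - q^2) P :=
    hind.comp (φ := fun x => x⁻¹) (ψ := fun x => x^2 - q^2) measurable_inv (by fun_prop)
  have iprod : Integrable (fun ω => (T ω)⁻¹ * ((X j ω)^2 - q^2)) P := hind2.integrable_mul iinv ij
  have hle : ∀ ω, ((X j ω)^2 - q^2) / ∑ i, X i ω ≤ (T ω)⁻¹ * ((X j ω)^2 - q^2) := by
    intro ω
    rw [hsum, div_eq_mul_inv, mul_comm]
    refine mul_le_mul_of_nonneg_right (inv_anti₀ (hTp ω) ?_) (hjnn ω)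
    linarith [hge j ω]
  have hnn : ∀ ω, 0 ≤ ((X j ω)^2 - q^2) / ∑ i, X i ω := by
    intro ω
    rw [hsum]
    exact div_nonneg (hjnn ω) (by linarith [hge j ω, hTp ω])
  have imain : Integrable (fun ω => ((X j ω)^2 - q^2) / ∑ i, X i ω) P := by
    refine iprod.mono' (Measurable.aestronglyMeasurable (by fun_prop)) (Eventually.of_forall fun ω => ?_)
    rw [Real.norm_of_nonneg (hnn ω)]; exact hle ω
  refine ⟨imain, ?_⟩
  calc _ ≤ ∫ ω, (T ω)⁻¹ * ((X j ω)^2 - q^2) ∂P := integral_mono imain iprod hle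
    _ = (∫ ω, (T ω)⁻¹ ∂P) * ∫ ω, ((X j ω)^2 - q^2) ∂P :=
        hind2.integral_mul_eq_mul_integral iinv.1 ij.1
    _ ≤ (1 / N * (1 + w / q / N)) * (w / 2) := by
        refine mul_le_mul hinv (hw2 j) (integral_nonneg hjnn) ?_
        exact (integral_nonneg fun ω => inv_nonneg.mpr (hTp ω).le).trans hinv
    _ = _ := by ring

lemma ptwise (M : ℕ) (x p r : Fin M → ℝ) (t S : ℝ) (hS : S = ∑ j, (p j + r j)) (hp : 0 < S) :
    t^2 * (S - ∑ j, (p j - r j)^2 / S) ≤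
      ∑ j, (p j * ∑ i, (x i - if i = j then t else 0)^2 + r j * ∑ i, (x i - if i = j then -t else 0)^2) := by
  have h : ∀ (u : ℝ) (j : Fin M), ∑ i, (x i - if i = j then u else 0)^2 = ∑ i, (x i)^2 - 2 * u * x j + u^2 := by
    intro u j
    have : ∀ i, (x i - if i = j then u else 0)^2 = (x i)^2 + if i = j then (- 2 * u * x i + u^2) else 0 := by
      intro i; split_ifs <;> ring
    simp_rw [this, Finset.sum_add_distrib]
    simp; ring
  simp_rw [h]
  have e : ∑ j, (p j * (∑ i, (x i)^2 - 2 * t * x j + t^2) + r j * (∑ i, (x i)^2 - 2 * (-t) * x j + (-t)^2)) =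
      t^2 * (S - ∑ j, (p j - r j)^2 / S) + ∑ j, S * (x j - t * (p j - r j) / S)^2 := by
    have e1 : ∀ j, p j * (∑ i, (x i)^2 - 2 * t * x j + t^2) + r j * (∑ i, (x i)^2 - 2 * (-t) * x j + (-t)^2) =
      (∑ i, (x i)^2 + t^2) * (p j + r j) - 2 * t * (x j * (p j - r j)) := by intro j; ring
    have e2 : ∀ j, S * (x j - t * (p j - r j) / S)^2 = S * (x j)^2 - 2 * t * (x j * (p j - r j)) + t^2 * ((p j - r j)^2 / S) := by
      intro j; field_simp; ring
    simp_rw [e1, e2, Finset.sum_add_distrib, Finset.sum_sub_distrib, ← Finset.mul_sum, ← hS]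
    ring
  rw [e]
  have : 0 ≤ ∑ j, S * (x j - t * (p j - r j) / S)^2 := Finset.sum_nonneg fun j _ => by positivity
  linarith

def sg (b : Bool) : ℝ := if b then 1 else -1

lemma block (n M : ℕ) (hM : 2 ≤ M) (θ : Fin n → ℝ) (s m : ℝ) (hs : 0 < s) (e : Fin M → Fin n)
    (he : Function.Injective e) (hθ : ∀ j, θ (e j) = 0) (est : (Fin n → ℝ) → Fin n → ℝ) (hest : Measurable est) :
    ENNReal.ofReal (2 * M * ((s*m)^2 * (1 - Real.exp (m^2) / 2 / ((M:ℝ)-1) * (1 + Real.exp (m^2) / Real.exp (-m^2/2) / ((M:ℝ)-1))))) ≤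
    ∑ a : Fin M × Bool, ∫⁻ y, ENNReal.ofReal (∑ i, (est y (e i) - Function.update θ (e a.1) (sg a.2 * (s*m)) (e i))^2)
      ∂(gsm n (Function.update θ (e a.1) (sg a.2 * (s*m))) s) := by
  classical
  set t := s * m with ht
  set w := Real.exp (m^2) with hw
  set q := Real.exp (-m^2/2) with hq
  set P := gsm n θ s with hP
  have : IsProbabilityMeasure P := by rw [hP]; unfold gsm; infer_instance
  set X : Fin M → (Fin n → ℝ) → ℝ := fun j y => psi m s (y (e j)) with hX
  have hpm : Measurable (psi m s) := by unfold psi; fun_prop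
  have hmp : ∀ j, MeasurePreserving (fun y : Fin n → ℝ => y (e j)) P (gaussianReal 0 ((s^2).toNNReal)) := by
    intro j
    have := measurePreserving_eval (fun i => gaussianReal (θ i) ((s^2).toNNReal)) (e j)
    rw [hθ] at this
    exact this
  have hXm : ∀ j, Measurable (X j) := fun j => hpm.comp (measurable_pi_apply _)
  have hI : iIndepFun X P := by
    have h0 : iIndepFun (fun i (y : Fin n → ℝ) => psi m s (y i)) P :=
      iIndepFun_pi (fun j => hpm.aemeasurable)
    exact h0.precomp he
  have hmean : ∀ j, ∫ y, X j y ∂P = 1 := by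
    intro j
    rw [← (psi_int hs m).2, ← (hmp j).map_eq, integral_map (hmp j).measurable.aemeasurable hpm.aestronglyMeasurable]
  have hi2 : ∀ j, Integrable (fun y => (X j y)^2) P := by
    intro j
    exact (hmp j).integrable_comp_of_integrable (psi_sq_int hs m).1
  have hsq : ∀ j, ∫ y, (X j y)^2 ∂P = (Real.exp (m^2) + Real.exp (-m^2)) / 2 := by
    intro j
    rw [← (psi_sq_int hs m).2, ← (hmp j).map_eq, integral_map (hmp j).measurable.aemeasurable (hpm.pow_const 2).aestronglyMeasurable]
  have hL : ∀ j, MemLp (X j) 2 P := fun j => (memLp_two_iff_integrable_sq (hXm j).aestronglyMeasurable).2 (hi2 j)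
  have hq0 : 0 < q := Real.exp_pos _
  have hq2 : q^2 = Real.exp (-m^2) := by rw [hq, ← Real.exp_nat_mul]; congr 1; push_cast; ring
  have hge : ∀ j y, q ≤ X j y := fun j y => psi_ge _ _ _
  have hee : Real.exp (-m^2) ≤ w := Real.exp_le_exp.2 (by nlinarith [sq_nonneg m])
  have R := recip P M hM X hXm hI q w hq0 hge hmean hL (fun j => by rw [hsq]; linarith)
    (fun j => by
      rw [integral_sub (hi2 j) (integrable_const _), hsq]; simp only [integral_const, probReal_univ, one_smul]; rw [hq2]
      linarith [Real.exp_pos (-m^2)])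
  set N : ℝ := (M:ℝ) - 1 with hN
  -- likelihood ratios
  set l : Fin M → Bool → (Fin n → ℝ) → ℝ := fun j b y => Real.exp ((sg b * t * y (e j) - (sg b * t)^2/2) / s^2) with hl
  have hl1 : ∀ j y, l j true y + l j false y = 2 * X j y := by
    intro j y
    simp only [hl, hX, psi, sg, ht, if_true]
    simp only [Bool.false_eq_true, if_false]
    rw [show (1 * (s*m) * y (e j) - (1 * (s*m))^2/2) / s^2 = m / s * y (e j) - m^2/2 by field_simp,
      show (-1 * (s*m) * y (e j) - (-1 * (s*m))^2/2) / s^2 = -(m / s) * y (e j) - m^2/2 by field_simp]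
    ring
  have hl2 : ∀ j y, l j true y * l j false y = q^2 := by
    intro j y
    simp only [hl, sg, ht, if_true, hq2]
    simp only [Bool.false_eq_true, if_false]
    rw [← Real.exp_add]; congr 1; field_simp; ring
  have hl3 : ∀ j y, (l j true y - l j false y)^2 = 4 * ((X j y)^2 - q^2) := by
    intro j y
    have a := hl1 j y
    have b := hl2 j y
    rw [show (l j true y - l j false y)^2 = (l j true y + l j false y)^2 - 4 * (l j true y * l j false y) by ring, a, b]; ring
  have hlp : ∀ j b y, 0 < l j b y := fun j b y => Real.exp_pos _
  have hlm : ∀ j b, Measurable (l j b) := by intro j b; simp only [hl]; fun_prop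
  have hestm : ∀ i, Measurable fun y => est y i := fun i => (measurable_pi_apply i).comp hest
  set loss : Fin M × Bool → (Fin n → ℝ) → ℝ := fun a y => ∑ i, (est y (e i) - Function.update θ (e a.1) (sg a.2 * t) (e i))^2 with hloss
  have hlossm : ∀ a, Measurable (loss a) := by intro a; simp only [hloss]; fun_prop
  have hloss2 : ∀ a y, loss a y = ∑ i, (est y (e i) - if i = a.1 then sg a.2 * t else 0)^2 := by
    intro a y
    refine Finset.sum_congr rfl fun i _ => ?_
    by_cases h : i = a.1
    · simp [h]
    · rw [Function.update_of_ne (fun hh => h (he hh)), hθ, if_neg h]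
  have hlossn : ∀ a y, 0 ≤ loss a y := fun a y => Finset.sum_nonneg fun i _ => sq_nonneg _
  set g : (Fin n → ℝ) → ℝ := fun y => t^2 * (∑ j, 2 * X j y - ∑ j, 2 * (((X j y)^2 - q^2) / ∑ i, X i y)) with hg
  have key : ∀ y, g y ≤ ∑ a : Fin M × Bool, l a.1 a.2 y * loss a y := by
    intro y
    have hSp : 0 < ∑ i, X i y := Finset.sum_pos (fun i _ => lt_of_lt_of_le hq0 (hge i y)) ⟨⟨0, by omega⟩, Finset.mem_univ _⟩
    have := ptwise M (fun i => est y (e i)) (fun j => l j true y) (fun j => l j false y) t (2 * ∑ j, X j y)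
      (by simp_rw [hl1, Finset.mul_sum]) (by linarith)
    rw [Fintype.sum_prod_type]
    simp only [Fintype.sum_bool, hloss2]
    simp only [sg, if_true, one_mul, Bool.false_eq_true, if_false, neg_mul]
    refine le_trans (le_of_eq ?_) this
    simp only [hg, hl3]
    congr 2
    · rw [Finset.mul_sum]
    · refine Finset.sum_congr rfl fun j _ => ?_
      field_simp; ring
  have gi1 : Integrable (fun y => ∑ j, 2 * X j y) P := integrable_finsetSum _ fun j _ => ((hL j).integrable (by norm_num)).const_mul _
  have gi2 : Integrable (fun y => ∑ j, 2 * (((X j y)^2 - q^2) / ∑ i, X i y)) P :=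
    integrable_finsetSum _ fun j _ => (R j).1.const_mul _
  have gi : Integrable g P := (gi1.sub gi2).const_mul _
  have gint : 2 * M * (t^2 * (1 - w / 2 / N * (1 + w / q / N))) ≤ ∫ y, g y ∂P := by
    simp only [hg]
    rw [integral_const_mul, integral_sub gi1 gi2, integral_finsetSum _ fun j _ => ((hL j).integrable (by norm_num)).const_mul _,
      integral_finsetSum _ fun j _ => (R j).1.const_mul _]
    simp_rw [integral_const_mul, hmean]
    have : ∑ j, 2 * ∫ y, ((X j y)^2 - q^2) / ∑ i, X i y ∂P ≤ ∑ j : Fin M, 2 * (w / 2 / N * (1 + w / q / N)) :=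
      Finset.sum_le_sum fun j _ => by linarith [(R j).2]
    simp only [Finset.sum_const, Finset.card_univ, Fintype.card_fin, nsmul_eq_mul] at this ⊢
    nlinarith [mul_le_mul_of_nonneg_left this (sq_nonneg t)]
  have tilt : ∀ a : Fin M × Bool, ∫⁻ y, ENNReal.ofReal (loss a y) ∂(gsm n (Function.update θ (e a.1) (sg a.2 * t)) s) =
      ∫⁻ y, ENNReal.ofReal (l a.1 a.2 y * loss a y) ∂P := by
    intro a
    rw [gsm_tilt n θ hs (e a.1) (hθ _), lintegral_withDensity_eq_lintegral_mul _ (by fun_prop) (hlossm a).ennreal_ofReal]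
    refine lintegral_congr fun y => ?_
    rw [Pi.mul_apply, ENNReal.ofReal_mul (hlp _ _ _).le]
  calc _ ≤ ENNReal.ofReal (∫ y, g y ∂P) := ENNReal.ofReal_le_ofReal gint
    _ ≤ ∫⁻ y, ENNReal.ofReal (g y) ∂P := ENNReal.ofReal_le_of_le_toReal (by
        rw [integral_eq_lintegral_pos_part_sub_lintegral_neg_part gi]
        linarith [ENNReal.toReal_nonneg (a := ∫⁻ y, ENNReal.ofReal (-g y) ∂P)])
    _ ≤ ∫⁻ y, ∑ a : Fin M × Bool, ENNReal.ofReal (l a.1 a.2 y * loss a y) ∂P := by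
        refine lintegral_mono fun y => ?_
        rw [← ENNReal.ofReal_sum_of_nonneg fun a _ => mul_nonneg (hlp _ _ _).le (hlossn _ _)]
        exact ENNReal.ofReal_le_ofReal (key y)
    _ = ∑ a : Fin M × Bool, ∫⁻ y, ENNReal.ofReal (l a.1 a.2 y * loss a y) ∂P :=
        lintegral_finsetSum _ fun a _ => ((hlm _ _).mul (hlossm _)).ennreal_ofReal
    _ = _ := Finset.sum_congr rfl fun a _ => (tilt a).symm

lemma sum_upd {B A : Type*} [Fintype B] [DecidableEq B] [Fintype A] (b : B) (G : (B → A) → ℝ≥0∞) :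
    ∑ f : B → A, ∑ a, G (Function.update f b a) = (Fintype.card A : ℝ≥0∞) * ∑ f, G f := by
  classical
  let E : (B → A) × A ≃ (B → A) × A :=
    { toFun := fun x => (Function.update x.1 b x.2, x.1 b)
      invFun := fun x => (Function.update x.1 b x.2, x.1 b)
      left_inv := fun x => by simp
      right_inv := fun x => by simp }
  rw [← Fintype.sum_prod_type' (f := fun f a => G (Function.update f b a))]
  have := Equiv.sum_comp E (fun x : (B → A) × A => G x.1)
  simp only [E, Equiv.coe_fn_mk] at this
  rw [this, Fintype.sum_prod_type]
  simp [Finset.mul_sum]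

def thF {n k M : ℕ} (e : Fin k × Fin M → Fin n) (t : ℝ) (f : Fin k → Fin M × Bool) : Fin n → ℝ :=
  fun i => ∑ b, if e (b, (f b).1) = i then sg (f b).2 * t else 0

lemma sg_sq (b : Bool) (t : ℝ) : (sg b * t)^2 = t^2 := by cases b <;> simp [sg]

lemma thF_mem {n k M : ℕ} (e : Fin k × Fin M → Fin n) (he : Function.Injective e) (t : ℝ) (f : Fin k → Fin M × Bool) :
    thF e t f ∈ paramSet n k t := by
  classical
  have hinj : Function.Injective (fun b => e (b, (f b).1)) := by
    intro b c h
    exact (Prod.ext_iff.1 (he h)).1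
  constructor
  · have : {i | thF e t f i ≠ 0} ⊆ ((Finset.univ.image (fun b => e (b, (f b).1)) : Finset (Fin n)) : Set (Fin n)) := by
      intro i hi
      by_contra hc
      apply hi
      unfold thF
      refine Finset.sum_eq_zero fun b _ => ?_
      rw [if_neg]
      rintro rfl
      exact hc (by simp)
    refine (Set.ncard_le_ncard this (Finset.finite_toSet _)).trans ?_
    rw [Set.ncard_coe_finset]
    exact Finset.card_image_le.trans (by simp)
  · have h2 : ∀ i, (thF e t f i)^2 = ∑ b, if e (b, (f b).1) = i then t^2 else 0 := by
      intro i
      by_cases h : ∃ b, e (b, (f b).1) = i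
      · obtain ⟨b, hb⟩ := h
        unfold thF
        have h0 : ∀ c, c ≠ b → e (c, (f c).1) ≠ i := fun c hc hh => hc (hinj (hh.trans hb.symm))
        rw [Finset.sum_eq_single b (fun c _ hc => by rw [if_neg (h0 c hc)]) (by simp),
          Finset.sum_eq_single b (fun c _ hc => by rw [if_neg (h0 c hc)]) (by simp), if_pos hb, if_pos hb, sg_sq]
      · push Not at h
        unfold thF
        simp [h]
    simp_rw [h2]
    rw [Finset.sum_comm]
    simp

lemma thF_upd {n k M : ℕ} (e : Fin k × Fin M → Fin n) (he : Function.Injective e) (t : ℝ) (f : Fin k → Fin M × Bool)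
    (b : Fin k) : ∃ θ : Fin n → ℝ, (∀ j, θ (e (b, j)) = 0) ∧ ∀ a, thF e t (Function.update f b a) =
      Function.update θ (e (b, a.1)) (sg a.2 * t) := by
  classical
  set θ : Fin n → ℝ := fun i => ∑ c ∈ Finset.univ.erase b, if e (c, (f c).1) = i then sg (f c).2 * t else 0 with hθ
  have h0 : ∀ j, θ (e (b, j)) = 0 := by
    intro j
    refine Finset.sum_eq_zero fun c hc => ?_
    rw [if_neg]
    intro h
    exact (Finset.ne_of_mem_erase hc) (Prod.ext_iff.1 (he h)).1
  refine ⟨θ, h0, fun a => ?_⟩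
  ext i
  have h1 : thF e t (Function.update f b a) i = (if e (b, a.1) = i then sg a.2 * t else 0) + θ i := by
    unfold thF
    rw [← Finset.add_sum_erase _ _ (Finset.mem_univ b)]
    simp only [Function.update_self, hθ]
    congr 1
    refine Finset.sum_congr rfl fun c hc => ?_
    rw [Function.update_of_ne (Finset.ne_of_mem_erase hc)]
  rw [h1]
  by_cases h : e (b, a.1) = i
  · subst h; simp [h0]
  · rw [if_neg h, Function.update_of_ne (Ne.symm h), zero_add]

lemma globalLB (n k M : ℕ) (hM : 2 ≤ M) (s m : ℝ) (hs : 0 < s) (e : Fin k × Fin M → Fin n)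
    (he : Function.Injective e) :
    ENNReal.ofReal (k * ((s*m)^2 * (1 - Real.exp (m^2) / 2 / ((M:ℝ)-1) * (1 + Real.exp (m^2) / Real.exp (-m^2/2) / ((M:ℝ)-1))))) ≤
      minimaxRisk n s (paramSet n k (s * m)) := by
  classical
  unfold _root_.minimaxRisk
  refine le_iInf₂ fun est hest => ?_
  set B := (s*m)^2 * (1 - Real.exp (m^2) / 2 / ((M:ℝ)-1) * (1 + Real.exp (m^2) / Real.exp (-m^2/2) / ((M:ℝ)-1))) with hB
  set t := s * m with ht
  set R := ⨆ θ ∈ paramSet n k t, risk n s est θ with hR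
  set br : Fin k → (Fin k → Fin M × Bool) → ℝ≥0∞ := fun b f =>
    ∫⁻ y, ENNReal.ofReal (∑ i, (est y (e (b, i)) - thF e t f (e (b, i)))^2) ∂(gsm n (thF e t f) s) with hbr
  have hestm : ∀ i, Measurable fun y => est y i := fun i => (measurable_pi_apply i).comp hest
  have h1 : ∀ f, ∑ b, br b f ≤ R := by
    intro f
    refine le_trans ?_ (le_iSup₂_of_le (thF e t f) (thF_mem e he t f) le_rfl)
    simp only [hbr]
    rw [← lintegral_finsetSum _ fun b _ => Measurable.ennreal_ofReal (by fun_prop)]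
    unfold risk
    refine lintegral_mono fun y => ?_
    rw [← ENNReal.ofReal_sum_of_nonneg fun a _ => Finset.sum_nonneg fun i _ => sq_nonneg _]
    refine ENNReal.ofReal_le_ofReal ?_
    rw [← Fintype.sum_prod_type' (f := fun b i => (est y (e (b, i)) - thF e t f (e (b, i)))^2)]
    rw [← Finset.sum_image (s := Finset.univ) (g := e) (f := fun i => (est y i - thF e t f i)^2) (fun a _ b _ h => he h)]
    exact Finset.sum_le_sum_of_subset_of_nonneg (Finset.subset_univ _) fun i _ _ => sq_nonneg _
  have hM0 : (2 * M : ℝ≥0∞) ≠ 0 := by simp; omega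
  have hMt : (2 * M : ℝ≥0∞) ≠ ⊤ := by finiteness
  have h2 : ∀ b f, (2 * M : ℝ≥0∞) * ENNReal.ofReal B ≤ ∑ a, br b (Function.update f b a) := by
    intro b f
    obtain ⟨θ, hθ, hu⟩ := thF_upd e he t f b
    have := block n M hM θ s m hs (fun j => e (b, j)) (fun i j h => (Prod.ext_iff.1 (he h)).2) hθ est hest
    rw [← hB, ENNReal.ofReal_mul (by positivity), ENNReal.ofReal_mul (by norm_num)] at this
    simp only [ENNReal.ofReal_ofNat, ENNReal.ofReal_natCast] at this
    refine this.trans (le_of_eq ?_)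
    refine Finset.sum_congr rfl fun a _ => ?_
    simp only [hbr, hu]; rfl
  set K : ℝ≥0∞ := (Fintype.card (Fin k → Fin M × Bool) : ℝ≥0∞) with hK
  have : Nonempty (Fin k → Fin M × Bool) := ⟨fun _ => (⟨0, by omega⟩, true)⟩
  have hK0 : K ≠ 0 := by rw [hK]; exact_mod_cast Fintype.card_ne_zero
  have hKt : K ≠ ⊤ := ENNReal.natCast_ne_top _
  have h3 : ∀ b, K * ENNReal.ofReal B ≤ ∑ f, br b f := by
    intro b
    have h := Finset.sum_le_sum fun f (_ : f ∈ (Finset.univ : Finset (Fin k → Fin M × Bool))) => h2 b f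
    rw [sum_upd, Finset.sum_const, nsmul_eq_mul, Finset.card_univ, Fintype.card_prod, Fintype.card_bool, Fintype.card_fin] at h
    rw [← ENNReal.mul_le_mul_iff_right hM0 hMt]
    calc _ = K * (2 * M * ENNReal.ofReal B) := by ring
      _ ≤ _ := h
      _ = _ := by push_cast; ring
  rw [ENNReal.ofReal_mul (by positivity), ENNReal.ofReal_natCast, ← ENNReal.mul_le_mul_iff_right hK0 hKt]
  calc K * (k * ENNReal.ofReal B) = ∑ b : Fin k, K * ENNReal.ofReal B := by
        rw [Finset.sum_const, nsmul_eq_mul, Finset.card_univ, Fintype.card_fin]; ring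
    _ ≤ ∑ b, ∑ f, br b f := Finset.sum_le_sum fun b _ => h3 b
    _ = ∑ f, ∑ b, br b f := Finset.sum_comm
    _ ≤ ∑ f : Fin k → Fin M × Bool, R := Finset.sum_le_sum fun f _ => h1 f
    _ = K * R := by rw [Finset.sum_const, nsmul_eq_mul, Finset.card_univ]

theorem partA
    (k : ℕ → ℕ) (τ σ ε μ : ℕ → ℝ)
    (hk : ∀ n, 1 ≤ n → 1 ≤ k n ∧ k n ≤ n)
    (hσ : ∀ n, 0 < σ n)
    (hε : ∀ n, ε n = (k n : ℝ) / n) (hμ : ∀ n, μ n = τ n / σ n)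
    (hε0 : Tendsto ε atTop (𝓝 0)) (hμtop : Tendsto μ atTop atTop)
    (hμo : Tendsto (fun n => μ n / Real.sqrt (Real.log (ε n)⁻¹)) atTop (𝓝 0)) :
    (∃ c : ℕ → ℝ, Tendsto c atTop (𝓝 1) ∧
      ∀ᶠ n : ℕ in atTop,
        ENNReal.ofReal ((n : ℝ) * σ n ^ 2 *
            (ε n * μ n ^ 2 - 1 / 2 * ε n ^ 2 * μ n ^ 2 * Real.exp (μ n ^ 2) * c n)) ≤
          minimaxRisk n (σ n) (paramSet n (k n) (τ n))) := by
  have hpos : ∀ᶠ n in atTop, 0 < ε n := by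
    filter_upwards [eventually_ge_atTop 1] with n hn
    have := (hk n hn).1
    rw [hε]
    have : (0:ℝ) < k n := by exact_mod_cast this
    have : (0:ℝ) < n := by exact_mod_cast hn
    positivity
  have hEE := eps_exp ε μ hpos hε0 hμtop hμo (3/2) (by norm_num)
  set M : ℕ → ℕ := fun n => n / k n with hMdef
  set N : ℕ → ℝ := fun n => (M n : ℝ) - 1 with hN
  have hb : ∀ᶠ n in atTop, 1 - 2 * ε n ≤ N n * ε n ∧ N n * ε n ≤ 1 := by
    filter_upwards [eventually_ge_atTop 1, hpos] with n hn hp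
    have hk1 := (hk n hn).1
    have hkp : (0:ℝ) < k n := by exact_mod_cast hk1
    have hnp : (0:ℝ) < n := by exact_mod_cast hn
    have u : (M n : ℝ) * k n ≤ n := by exact_mod_cast Nat.div_mul_le_self n (k n)
    have l : (n : ℝ) ≤ (M n + 1) * k n := by
      have := (Nat.lt_div_mul_add hk1 (a := n)).le
      have : n ≤ (M n + 1) * k n := by simp only [hMdef]; linarith
      exact_mod_cast this
    have e : N n * ε n = ((M n : ℝ) * k n - k n) / n := by simp only [hN]; rw [hε]; ring
    rw [e, le_div_iff₀ hnp, div_le_iff₀ hnp]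
    constructor
    · rw [hε]; field_simp; linarith
    · linarith
  have hNe : Tendsto (fun n => N n * ε n) atTop (𝓝 1) := by
    refine tendsto_of_tendsto_of_tendsto_of_le_of_le' (g := fun n => 1 - 2 * ε n) ?_ tendsto_const_nhds
      (hb.mono fun n h => h.1) (hb.mono fun n h => h.2)
    simpa using (hε0.const_mul 2).const_sub 1
  refine ⟨fun n => 1 / (N n * ε n) * (1 + ε n * Real.exp (3/2 * μ n ^2) / (N n * ε n)), ?_, ?_⟩
  · have := (hNe.inv₀ one_ne_zero).mul ((hEE.div hNe one_ne_zero).const_add 1)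
    simpa [one_div] using this
  have hsmall : ∀ᶠ n in atTop, ε n < 1/3 := hε0.eventually (gt_mem_nhds (by norm_num))
  filter_upwards [eventually_ge_atTop 1, hpos, hb, hsmall] with n hn hp hbn hsn
  have hk1 := (hk n hn).1
  have hkp : (0:ℝ) < k n := by exact_mod_cast hk1
  have hnp : (0:ℝ) < n := by exact_mod_cast hn
  have hNp : 0 < N n := by
    have : 0 < N n * ε n := by linarith [hbn.1]
    exact pos_of_mul_pos_left this hp.le
  have hM2 : 2 ≤ M n := by
    have : (1:ℝ) < M n := by simp only [hN] at hNp; linarith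
    have : 1 < M n := by exact_mod_cast this
    omega
  have hle : k n * M n ≤ n := Nat.mul_div_le n (k n)
  have G := globalLB n (k n) (M n) hM2 (σ n) (μ n) (hσ n) (fun p => Fin.castLE hle (finProdFinEquiv p))
    ((Fin.castLE_injective hle).comp finProdFinEquiv.injective)
  have hτ : σ n * μ n = τ n := by rw [hμ]; have := (hσ n).ne'; field_simp
  have he : Real.exp (μ n ^ 2) / Real.exp (-μ n ^ 2 / 2) = Real.exp (3/2 * μ n ^ 2) := by
    rw [← Real.exp_sub]; congr 1; ring
  rw [he] at G
  refine (le_of_eq ?_).trans (hτ ▸ G)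
  congr 1
  have hkε : (k n : ℝ) = ε n * n := by rw [hε]; field_simp
  change _ = (k n : ℝ) * ((τ n)^2 * (1 - Real.exp (μ n ^2) / 2 / N n * (1 + Real.exp (3/2 * μ n ^2) / N n)))
  rw [hkε, ← hτ]
  field_simp

/-- Theorem `thm::regime_2`, Regime II. -/
theorem statement3
    (k : ℕ → ℕ) (τ σ ε μ : ℕ → ℝ)
    (hk : ∀ n, 1 ≤ n → 1 ≤ k n ∧ k n ≤ n)
    (hτ : ∀ n, 0 < τ n) (hσ : ∀ n, 0 < σ n)
    (hε : ∀ n, ε n = (k n : ℝ) / n) (hμ : ∀ n, μ n = τ n / σ n)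
    (hε0 : Tendsto ε atTop (𝓝 0)) (hμtop : Tendsto μ atTop atTop)
    (hμo : Tendsto (fun n => μ n / Real.sqrt (Real.log (ε n)⁻¹)) atTop (𝓝 0)) :
    (∃ c : ℕ → ℝ, Tendsto c atTop (𝓝 1) ∧
      ∀ᶠ n : ℕ in atTop,
        ENNReal.ofReal ((n : ℝ) * σ n ^ 2 *
            (ε n * μ n ^ 2 - 1 / 2 * ε n ^ 2 * μ n ^ 2 * Real.exp (μ n ^ 2) * c n)) ≤
          minimaxRisk n (σ n) (paramSet n (k n) (τ n))) ∧
    (∃ c : ℕ → ℝ, Tendsto c atTop (𝓝 (Real.sqrt (2 / Real.pi))) ∧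
      ∀ᶠ n : ℕ in atTop,
        (⨆ θ ∈ paramSet n (k n) (τ n),
            risk n (σ n)
              (elasticEst n (2 * σ n * μ n)
                ((2 * ε n * μ n ^ 2 * Real.exp (3 / 2 * μ n ^ 2))⁻¹ - 1)) θ) =
          ENNReal.ofReal ((n : ℝ) * σ n ^ 2 *
            (ε n * μ n ^ 2 - c n * ε n ^ 2 * μ n * Real.exp (μ n ^ 2))) ∧
        minimaxRisk n (σ n) (paramSet n (k n) (τ n)) ≤
          ENNReal.ofReal ((n : ℝ) * σ n ^ 2 *
            (ε n * μ n ^ 2 - c n * ε n ^ 2 * μ n * Real.exp (μ n ^ 2)))) := by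
  exact ⟨partA k τ σ ε μ hk hσ hε hμ hε0 hμtop hμo, partB k τ σ ε μ hk hσ hε hμ hε0 hμtop hμo⟩
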